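/- arXiv:2603.25717 — 5 statements merged into one kernel-verified Lean document; each statement's English description precedes it below -/
import Mathlib

section
/- For every positive integer l, the multiple zeta star value ζ*(1,2,…,2) with l twos satisfies ζ*(1,{2}^l) = 2·ζ(2l+1), i.e. ∑_{0 < m₁ ≤ m₂ ≤ ⋯ ≤ m_{l+1}} 1/(m₁ · m₂² ⋯ m_{l+1}²) = 2·∑_{n=1}^∞ 1/n^{2l+1}. -/
open scoped BigOperators

noncomputable def cc (N k : ℕ) : ℝ := (N.choose k : ℝ) / ((N + k).choose k : ℝ)

lemma cc_den_pos (N k : ℕ) : (0 : ℝ) < ((N + k).choose k : ℝ) := by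
  exact_mod_cast Nat.choose_pos (by omega)

lemma cc_nonneg (N k : ℕ) : 0 ≤ cc N k := by unfold cc; positivity

lemma cc_le_one (N k : ℕ) : cc N k ≤ 1 := by
  unfold cc
  rw [div_le_one (cc_den_pos N k)]
  exact_mod_cast Nat.choose_le_choose k (by omega)

lemma cc_zero_of_lt {N k : ℕ} (h : N < k) : cc N k = 0 := by
  unfold cc; rw [Nat.choose_eq_zero_of_lt h]; simp

lemma cc_step (N k : ℕ) (hk : k ≤ N + 1) :
    cc N k * ((N : ℝ) + 1) ^ 2 = cc (N + 1) k * (((N : ℝ) + 1) ^ 2 - (k : ℝ) ^ 2) := by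
  have h1 := Nat.choose_mul_succ_eq N k
  have h2 := Nat.choose_mul_succ_eq (N + k) k
  have e1 : ((N.choose k : ℕ) : ℝ) * (N + 1) = ((N + 1).choose k : ℝ) * ((N : ℝ) + 1 - k) := by
    have := congrArg (Nat.cast : ℕ → ℝ) h1
    rw [Nat.cast_mul, Nat.cast_mul, Nat.cast_sub hk] at this
    push_cast at this
    exact this
  have e2 : (((N + k).choose k : ℕ) : ℝ) * (N + k + 1) = ((N + 1 + k).choose k : ℝ) * (N + 1) := by
    rw [show N + k + 1 - k = N + 1 by omega, show N + k + 1 = N + 1 + k by omega] at h2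
    have := congrArg (Nat.cast : ℕ → ℝ) h2
    push_cast at this
    linarith
  unfold cc
  have p1 := cc_den_pos N k
  have p2 := cc_den_pos (N + 1) k
  rw [div_mul_eq_mul_div, div_mul_eq_mul_div, div_eq_div_iff p1.ne' p2.ne']
  linear_combination ((N : ℝ) + 1) * ((N + 1 + k).choose k : ℝ) * e1
    - ((N + 1).choose k : ℝ) * ((N : ℝ) + 1 - k) * e2

lemma cc_succ (N k : ℕ) :
    cc N (k + 1) * ((N : ℝ) + k + 1) = cc N k * ((N : ℝ) - k) := by
  rcases le_or_gt k N with hk | hk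
  · have h1 := Nat.choose_succ_right_eq N k
    have h2 := Nat.add_one_mul_choose_eq (N + k) k
    have e1 : ((N.choose (k + 1) : ℕ) : ℝ) * (k + 1) = (N.choose k : ℝ) * ((N : ℝ) - k) := by
      have := congrArg (Nat.cast : ℕ → ℝ) h1
      rw [Nat.cast_mul, Nat.cast_mul, Nat.cast_sub hk] at this
      push_cast at this
      exact this
    have e2 : ((N : ℝ) + k + 1) * ((N + k).choose k : ℝ)
        = ((N + (k + 1)).choose (k + 1) : ℝ) * (k + 1) := by
      have := congrArg (Nat.cast : ℕ → ℝ) h2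
      push_cast at this
      exact this
    unfold cc
    have p1 := cc_den_pos N k
    have p2 := cc_den_pos N (k + 1)
    have hk0 : ((k : ℝ) + 1) ≠ 0 := by positivity
    rw [div_mul_eq_mul_div, div_mul_eq_mul_div, div_eq_div_iff p2.ne' p1.ne']
    linear_combination (N.choose (k + 1) : ℝ) * e2 + ((N + (k + 1)).choose (k + 1) : ℝ) * e1
  · rw [cc_zero_of_lt hk, cc_zero_of_lt (by omega)]; simp

lemma cc_sum (N M : ℕ) :
    2 * ∑ k ∈ Finset.range M, cc N (k + 1) * ((k : ℝ) + 1)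
      = N - cc N M * ((N : ℝ) - M) := by
  induction M with
  | zero => simp [cc]
  | succ M ih =>
    rw [Finset.sum_range_succ, mul_add, ih, ← cc_succ]
    push_cast
    ring

noncomputable def TT (l N : ℕ) : ℝ :=
  2 * ∑ k ∈ Finset.range N, cc N (k + 1) / ((k : ℝ) + 1) ^ (2 * l + 1)

lemma TT_ext (l N : ℕ) :
    TT l N = 2 * ∑ k ∈ Finset.range (N + 1), cc N (k + 1) / ((k : ℝ) + 1) ^ (2 * l + 1) := by
  rw [Finset.sum_range_succ, cc_zero_of_lt (by omega : N < N + 1)]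
  simp [TT]

lemma cc_diff (N k : ℕ) (hk : k ≤ N + 1) :
    cc (N + 1) k - cc N k = cc (N + 1) k * (k : ℝ) ^ 2 / ((N : ℝ) + 1) ^ 2 := by
  have := cc_step N k hk
  have h : ((N : ℝ) + 1) ^ 2 ≠ 0 := by positivity
  rw [eq_div_iff h]
  linear_combination -this

lemma TT_succ (l N : ℕ) :
    TT (l + 1) (N + 1) = TT (l + 1) N + TT l (N + 1) / ((N : ℝ) + 1) ^ 2 := by
  rw [TT_ext (l + 1) N, TT, TT, mul_div_assoc, ← mul_add, Finset.sum_div, ← Finset.sum_add_distrib]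
  congr 1
  refine Finset.sum_congr rfl fun k hk => ?_
  have := cc_diff N (k + 1) (by have := Finset.mem_range.1 hk; omega)
  rw [sub_eq_iff_eq_add] at this
  push_cast at this
  have hk0 : ((k : ℝ) + 1) ≠ 0 := by positivity
  have hN0 : ((N : ℝ) + 1) ≠ 0 := by positivity
  have e : cc (N + 1) (k + 1) / ((k : ℝ) + 1) ^ (2 * l + 1) / ((N : ℝ) + 1) ^ 2
      = (cc (N + 1) (k + 1) * ((k : ℝ) + 1) ^ 2 / ((N : ℝ) + 1) ^ 2)
        / ((k : ℝ) + 1) ^ (2 * (l + 1) + 1) := by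
    field_simp
    ring
  rw [e, ← add_div, add_comm (cc N (k + 1)), ← this]

lemma TT_zero_succ (N : ℕ) : TT 0 (N + 1) = TT 0 N + 1 / ((N : ℝ) + 1) := by
  have h := cc_sum (N + 1) (N + 1)
  have hN0 : ((N : ℝ) + 1) ≠ 0 := by positivity
  have e : 1 / ((N : ℝ) + 1)
      = 2 * ∑ k ∈ Finset.range (N + 1), cc (N + 1) (k + 1) * ((k : ℝ) + 1) / ((N : ℝ) + 1) ^ 2 := by
    rw [← Finset.sum_div, ← mul_div_assoc, h]
    push_cast
    field_simp
    ring
  rw [e, TT_ext 0 N, TT, ← mul_add, ← Finset.sum_add_distrib]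
  congr 1
  refine Finset.sum_congr rfl fun k hk => ?_
  have := cc_diff N (k + 1) (by have := Finset.mem_range.1 hk; omega)
  rw [sub_eq_iff_eq_add] at this
  push_cast at this
  have hk0 : ((k : ℝ) + 1) ≠ 0 := by positivity
  have h3 := eq_sub_of_add_eq' this.symm
  rw [h3]
  generalize cc (N + 1) (k + 1) = x
  field_simp
  try ring

lemma cc_tendsto (k : ℕ) :
    Filter.Tendsto (fun N => cc N k) Filter.atTop (nhds 1) := by
  induction k with
  | zero => simp [cc]
  | succ k ih =>
    have h : ∀ N : ℕ, cc N (k + 1) = cc N k * (1 - (2 * k + 1) / ((N : ℝ) + ((k : ℝ) + 1))) := by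
      intro N
      have h0 : ((N : ℝ) + k + 1) ≠ 0 := by positivity
      have := cc_succ N k
      rw [← eq_div_iff h0] at this
      rw [this, ← add_assoc]
      field_simp
      ring
    simp_rw [h]
    have h2 : Filter.Tendsto (fun N : ℕ => (2 * (k : ℝ) + 1) / ((N : ℝ) + ((k : ℝ) + 1)))
        Filter.atTop (nhds 0) :=
      Filter.Tendsto.const_div_atTop
        (Filter.tendsto_atTop_add_const_right _ _ tendsto_natCast_atTop_atTop) _
    have := ih.mul (h2.const_sub 1)
    simpa using this

lemma TT_tendsto (l : ℕ) (hl : 1 ≤ l) :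
    Filter.Tendsto (TT l) Filter.atTop
      (nhds (2 * ∑' n : ℕ+, (1 : ℝ) / ((n : ℕ) : ℝ) ^ (2 * l + 1))) := by
  have e : ∑' n : ℕ+, (1 : ℝ) / ((n : ℕ) : ℝ) ^ (2 * l + 1)
      = ∑' k : ℕ, (1 : ℝ) / ((k : ℝ) + 1) ^ (2 * l + 1) := by
    rw [tsum_pnat_eq_tsum_succ (f := fun n : ℕ => (1 : ℝ) / (n : ℝ) ^ (2 * l + 1))]
    push_cast
    rfl
  rw [e]
  have e2 : TT l = fun N => 2 * ∑' k : ℕ, cc N (k + 1) / ((k : ℝ) + 1) ^ (2 * l + 1) := by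
    funext N
    rw [TT, tsum_eq_sum]
    intro k hk
    rw [cc_zero_of_lt (by simpa [Nat.lt_succ_iff] using hk)]
    simp
  rw [e2]
  refine Filter.Tendsto.const_mul 2 ?_
  have hs : Summable (fun k : ℕ => (1 : ℝ) / ((k : ℝ) + 1) ^ (2 * l + 1)) := by
    have := (summable_nat_add_iff 1).2
      (Real.summable_one_div_nat_pow.2 (by omega : 1 < 2 * l + 1))
    simpa using this
  refine tendsto_tsum_of_dominated_convergence hs ?_ ?_
  · intro k
    exact (cc_tendsto (k + 1)).div_const _
  · refine Filter.Eventually.of_forall fun N k => ?_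
    have h0 := cc_nonneg N (k + 1)
    have h1 := cc_le_one N (k + 1)
    rw [Real.norm_of_nonneg (by positivity)]
    gcongr

lemma sum_Icc_pnat (T : ℕ → ℝ) (g : ℕ+ → ℝ) (h0 : T 0 = 0)
    (h : ∀ n : ℕ, T (n + 1) = T n + g n.succPNat) (N : ℕ+) :
    ∑ n ∈ Finset.Icc 1 N, g n = T N := by
  induction N using PNat.recOn with
  | one =>
    have := h 0
    rw [h0] at this
    simp only [Finset.Icc_self, Finset.sum_singleton, PNat.one_coe]
    rw [zero_add, zero_add] at this
    exact this.symm
  | succ N ih =>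
    have hi : Finset.Icc 1 (N + 1) = insert (N + 1) (Finset.Icc 1 N) := by
      ext x
      simp only [Finset.mem_Icc, Finset.mem_insert, one_le, true_and]
      rw [← PNat.coe_le_coe, ← PNat.coe_le_coe, ← PNat.coe_inj, PNat.add_coe, PNat.one_coe]
      omega
    rw [hi, Finset.sum_insert (by simp), ih, PNat.add_coe, PNat.one_coe, h]
    have : (N : ℕ).succPNat = N + 1 := by
      rw [← PNat.coe_inj]; simp
    rw [this, add_comm]

/-- summand -/
noncomputable def ww (l : ℕ) (f : Fin (l + 1) → ℕ+) : ℝ :=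
  (1 : ℝ) / (((f 0 : ℕ) : ℝ) * ∏ i : Fin l, (((f i.succ : ℕ) : ℝ)) ^ 2)

open Classical in
noncomputable def FF (l : ℕ) (N : ℕ+) : Finset (Fin (l + 1) → ℕ+) :=
  (Fintype.piFinset (fun _ => Finset.Icc 1 N)).filter Monotone

lemma mem_FF (l : ℕ) (N : ℕ+) (f : Fin (l + 1) → ℕ+) :
    f ∈ FF l N ↔ (∀ i, f i ≤ N) ∧ Monotone f := by
  simp [FF]

lemma ww_snoc (l : ℕ) (f : Fin (l + 2) → ℕ+) :
    ww (l + 1) f = ww l (Fin.init f) / ((f (Fin.last (l + 1)) : ℕ) : ℝ) ^ 2 := by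
  unfold ww
  rw [Fin.prod_univ_castSucc, div_div, mul_assoc]
  rfl

lemma snoc_mono (l : ℕ) (f : Fin (l + 1) → ℕ+) (n : ℕ+) (hf : Monotone f) (hn : ∀ i, f i ≤ n) :
    Monotone (Fin.snoc f n : Fin (l + 2) → ℕ+) := by
  intro i j hij
  induction j using Fin.lastCases with
  | last =>
    induction i using Fin.lastCases with
    | last => exact le_rfl
    | cast i => simpa using hn i
  | cast j =>
    induction i using Fin.lastCases with
    | last => exact absurd hij (not_le.2 (Fin.castSucc_lt_last j))
    | cast i => simpa using hf (by simpa using hij)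

lemma sum_FF_succ (l : ℕ) (N : ℕ+) :
    ∑ f ∈ FF (l + 1) N, ww (l + 1) f
      = ∑ n ∈ Finset.Icc 1 N, (∑ f ∈ FF l n, ww l f) / ((n : ℕ) : ℝ) ^ 2 := by
  simp_rw [Finset.sum_div]
  rw [Finset.sum_sigma']
  refine Finset.sum_bij' (fun f _ => (⟨f (Fin.last (l + 1)), Fin.init f⟩ : (_ : ℕ+) × (Fin (l + 1) → ℕ+)))
    (fun p _ => (Fin.snoc p.2 p.1 : Fin (l + 2) → ℕ+)) ?_ ?_ ?_ ?_ ?_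
  · intro f hf
    rw [mem_FF] at hf
    simp only [Finset.mem_sigma, Finset.mem_Icc, one_le, true_and, mem_FF]
    exact ⟨hf.1 _, fun i => hf.2 (Fin.le_last _), fun i j hij => hf.2 (by simpa using hij)⟩
  · rintro ⟨n, f⟩ hp
    simp only [Finset.mem_sigma, Finset.mem_Icc, one_le, true_and, mem_FF] at hp
    rw [mem_FF]
    refine ⟨fun i => ?_, snoc_mono l f n hp.2.2 hp.2.1⟩
    induction i using Fin.lastCases with
    | last => simpa using hp.1
    | cast i => simpa using (hp.2.1 i).trans hp.1
  · intro f _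
    exact Fin.snoc_init_self f
  · rintro ⟨n, f⟩ _
    simp
  · intro f _
    exact ww_snoc l f

lemma sum_FF (l : ℕ) : ∀ N : ℕ+, ∑ f ∈ FF l N, ww l f = TT l N := by
  induction l with
  | zero =>
    intro N
    rw [← sum_Icc_pnat (TT 0) (fun n => 1 / ((n : ℕ) : ℝ)) (by simp [TT])
      (fun n => by rw [TT_zero_succ]; simp) N]
    refine Finset.sum_bij' (fun f _ => f 0) (fun n _ => fun _ => n) ?_ ?_ ?_ ?_ ?_
    · intro f hf
      rw [mem_FF] at hf
      simpa using hf.1 0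
    · intro n hn
      rw [mem_FF]
      exact ⟨fun _ => (Finset.mem_Icc.1 hn).2, fun _ _ _ => le_rfl⟩
    · intro f _
      funext i
      rw [show i = 0 from Fin.ext (by have := i.isLt; simp)]
    · intro n _
      rfl
    · intro f _
      simp [ww]
  | succ l ih =>
    intro N
    rw [sum_FF_succ]
    simp_rw [ih]
    refine sum_Icc_pnat (TT (l + 1)) (fun n => TT l n / ((n : ℕ) : ℝ) ^ 2) (by simp [TT])
      (fun n => by rw [TT_succ]; simp) N

/-- ζ*(1,{2}^l) = 2 ζ(2l+1) for l ≥ 1. -/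
theorem zeta_star_one_twos (l : ℕ) (hl : 1 ≤ l) :
    (∑' m : {f : Fin (l + 1) → ℕ+ // Monotone f},
      (1 : ℝ) / (((m.1 0 : ℕ) : ℝ) * ∏ i : Fin l, (((m.1 i.succ : ℕ) : ℝ)) ^ 2))
    = 2 * ∑' n : ℕ+, (1 : ℝ) / ((n : ℕ) : ℝ) ^ (2 * l + 1) := by
  classical
  change (∑' m : {f : Fin (l + 1) → ℕ+ // Monotone f}, ww l m.1) = _
  let G : ℕ → Finset {f : Fin (l + 1) → ℕ+ // Monotone f} :=
    fun N => (FF l N.succPNat).subtype Monotone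
  have hG : ∀ N, ∑ m ∈ G N, ww l m.1 = TT l (N + 1) := by
    intro N
    rw [Finset.sum_subtype_of_mem (ww l) (fun f hf => ((mem_FF _ _ _).1 hf).2), sum_FF]
    rfl
  have hmono : Monotone G := by
    intro a b hab m hm
    simp only [G, Finset.mem_subtype, mem_FF] at hm ⊢
    exact ⟨fun i => (hm.1 i).trans (Nat.succPNat_mono hab), hm.2⟩
  have hex : ∀ m, ∃ N, m ∈ G N := by
    intro m
    refine ⟨(m.1 (Fin.last l) : ℕ), ?_⟩
    simp only [G, Finset.mem_subtype, mem_FF]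
    refine ⟨fun i => (m.2 (Fin.le_last i)).trans ?_, m.2⟩
    rw [← PNat.coe_le_coe]
    simp
  have hGt := Filter.tendsto_atTop_finset_of_monotone hmono hex
  have hlim : Filter.Tendsto (fun N => ∑ m ∈ G N, ww l m.1) Filter.atTop
      (nhds (2 * ∑' n : ℕ+, (1 : ℝ) / ((n : ℕ) : ℝ) ^ (2 * l + 1))) := by
    simp_rw [hG]
    exact (TT_tendsto l hl).comp (Filter.tendsto_add_atTop_nat 1)
  have hnn : ∀ m : {f : Fin (l + 1) → ℕ+ // Monotone f}, 0 ≤ ww l m.1 := by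
    intro m
    unfold ww
    positivity
  have hsm : Monotone (fun N => ∑ m ∈ G N, ww l m.1) := fun a b hab =>
    Finset.sum_le_sum_of_subset_of_nonneg (hmono hab) (fun m _ _ => hnn m)
  have hsum : Summable (fun m : {f : Fin (l + 1) → ℕ+ // Monotone f} => ww l m.1) := by
    refine summable_of_sum_le hnn (c := 2 * ∑' n : ℕ+, (1 : ℝ) / ((n : ℕ) : ℝ) ^ (2 * l + 1)) ?_
    intro s
    obtain ⟨N, hN⟩ := (hGt.eventually (Filter.eventually_ge_atTop s)).exists
    exact (Finset.sum_le_sum_of_subset_of_nonneg hN (fun m _ _ => hnn m)).trans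
      (hsm.ge_of_tendsto hlim N)
  exact tendsto_nhds_unique (hsum.hasSum.comp hGt) hlim
end

section
/- For integers k ≥ 0 and l > 0, ζ*(1,{2}^k,1,{2}^l) = 4·ζ(2k+1, 2l+1) + 2·ζ(2k+2l+2), where the right-hand side can also be written as ∑_{0 < m ≤ n} 2^{#{m,n}} / (m^{2k+1} n^{2l+1}). -/
open scoped BigOperators

/-- The weights `n!^2 / ((n-a)! (n+a)!)`, defined recursively in `a`. -/
noncomputable def ozW (n : ℕ) : ℕ → ℝ
  | 0 => 1
  | b + 1 => ozW n b * ((n : ℝ) - b) / ((n : ℝ) + b + 1)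

lemma ozW_succ (n b : ℕ) : ((n : ℝ) + b + 1) * ozW n (b + 1) = ((n : ℝ) - b) * ozW n b := by
  have : (n : ℝ) + b + 1 ≠ 0 := by positivity
  simp only [ozW]
  field_simp

lemma ozW_zero_of_lt (n : ℕ) : ∀ b, n < b → ozW n b = 0 := by
  intro b
  induction b with
  | zero => intro h; omega
  | succ b ih =>
    intro h
    rcases Nat.lt_or_ge n b with h1 | h1
    · simp [ozW, ih h1]
    · have : n = b := by omega
      subst this
      simp [ozW]

lemma ozW_bounds (n b : ℕ) : 0 ≤ ozW n b ∧ ozW n b ≤ 1 := by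
  induction b with
  | zero => simp [ozW]
  | succ b ih =>
    rcases Nat.lt_or_ge n (b + 1) with h1 | h1
    · rw [ozW_zero_of_lt n _ h1]; norm_num
    · have h2 : (b : ℝ) + 1 ≤ n := by exact_mod_cast h1
      have h3 : (0 : ℝ) ≤ b := by positivity
      simp only [ozW]
      refine ⟨div_nonneg (mul_nonneg ih.1 (by linarith)) (by linarith), ?_⟩
      rw [div_le_one (by linarith)]
      nlinarith [ih.1, ih.2]

lemma ozW_step (n b : ℕ) :
    ozW (n + 1) b * (((n : ℝ) + 1) ^ 2 - (b : ℝ) ^ 2) = ozW n b * ((n : ℝ) + 1) ^ 2 := by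
  induction b with
  | zero => simp [ozW]
  | succ b ih =>
    have h1 := ozW_succ (n + 1) b
    have h2 := ozW_succ n b
    have h3 : (n : ℝ) + b + 1 ≠ 0 := by positivity
    push_cast at h1 ⊢
    apply mul_left_cancel₀ h3
    linear_combination ((n : ℝ) - b) * ((n : ℝ) + b + 1) * h1 + ((n:ℝ) - b) * ih - ((n : ℝ) + 1) ^ 2 * h2

lemma ozW_tendsto (b : ℕ) : Filter.Tendsto (fun n => ozW n b) Filter.atTop (nhds 1) := by
  induction b with
  | zero => simp [ozW]
  | succ b ih =>
    have h : Filter.Tendsto (fun n : ℕ => (1 : ℝ) - (2 * b + 1) * (1 / ((n : ℝ) + b + 1)))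
        Filter.atTop (nhds (1 - (2 * b + 1) * 0)) := by
      refine tendsto_const_nhds.sub (tendsto_const_nhds.mul ?_)
      have := tendsto_one_div_add_atTop_nhds_zero_nat (𝕜 := ℝ)
      have h2 := this.comp (Filter.tendsto_add_atTop_nat b)
      refine h2.congr ?_
      intro n
      simp
    have h2 := ih.mul h
    simp only [mul_zero, sub_zero, mul_one] at h2
    refine h2.congr ?_
    intro n
    have : (n : ℝ) + b + 1 ≠ 0 := by positivity
    simp only [ozW]
    field_simp
    ring

/-- Weighted finite sums. -/
noncomputable def ozP (x : ℕ → ℝ) (n : ℕ) : ℝ := ∑ a ∈ Finset.range n, ozW n (a + 1) * x a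

lemma ozP_step (x y : ℕ → ℝ) (hxy : ∀ a, y a = ((a : ℝ) + 1) ^ 2 * x a) (n : ℕ) :
    ozP x (n + 1) = ozP x n + 1 / ((n : ℝ) + 1) ^ 2 * ozP y (n + 1) := by
  have h : ozP x n = ∑ a ∈ Finset.range (n + 1), ozW n (a + 1) * x a := by
    rw [Finset.sum_range_succ, ozW_zero_of_lt n (n + 1) (by omega)]
    simp [ozP]
  rw [h, ozP, ozP, Finset.mul_sum, ← Finset.sum_add_distrib]
  refine Finset.sum_congr rfl fun a _ => ?_
  have h1 := ozW_step n (a + 1)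
  have h3 : (n : ℝ) + 1 ≠ 0 := by positivity
  rw [hxy]
  push_cast at h1
  field_simp
  linear_combination x a * h1

lemma ozP_tele (n : ℕ) : ozP (fun a => 2 * ((a : ℝ) + 1)) n = n := by
  have h : ∀ N, ∑ a ∈ Finset.range N, ozW n (a + 1) * (2 * ((a : ℝ) + 1))
      = n - ((n : ℝ) - N) * ozW n N := by
    intro N
    induction N with
    | zero => simp [ozW]
    | succ N ih =>
      rw [Finset.sum_range_succ, ih]
      have := ozW_succ n N
      push_cast
      linear_combination this
  rw [ozP, h]; simp

/-- The coefficient sequence. -/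
noncomputable def ozC (g : ℕ → ℝ) (a : ℕ) : ℝ := 2 * g a + 4 * ∑ b ∈ Finset.range a, g b

lemma ozP_abel (g : ℕ → ℝ) (n : ℕ) :
    ozP (fun a => ((a : ℝ) + 1) * ozC g a) n = n * ozP (fun a => 2 * g a) n := by
  have h : ∀ N, ∑ a ∈ Finset.range N, ozW n (a + 1) * (((a : ℝ) + 1) * ozC g a)
      = n * ∑ a ∈ Finset.range N, ozW n (a + 1) * (2 * g a)
        - 2 * ((n : ℝ) - N) * ozW n N * ∑ a ∈ Finset.range N, g a := by
    intro N
    induction N with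
    | zero => simp
    | succ N ih =>
      rw [Finset.sum_range_succ, ih, Finset.sum_range_succ, Finset.sum_range_succ, ozC]
      have := ozW_succ n N
      push_cast
      linear_combination (2 * ∑ a ∈ Finset.range N, g a) * this
  rw [ozP, h]; simp [ozP]

/-- Truncated star sums, by recursion on the depth. -/
noncomputable def ozH (e : ℕ → ℕ) : ℕ → ℕ → ℝ
  | 0, _ => 1
  | d + 1, n => ∑ m ∈ Finset.range n, 1 / ((m : ℝ) + 1) ^ e d * ozH e d (m + 1)

lemma ozH_eq_of_step (e : ℕ → ℕ) (d : ℕ) (x : ℕ → ℝ)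
    (h : ∀ n, ozP x (n + 1) = ozP x n + 1 / ((n : ℝ) + 1) ^ e d * ozH e d (n + 1)) (n : ℕ) :
    ozH e (d + 1) n = ozP x n := by
  induction n with
  | zero => simp [ozH, ozP]
  | succ n ih => rw [h, ← ih]; simp only [ozH]; rw [Finset.sum_range_succ]

lemma ozH_first (e : ℕ → ℕ) (k : ℕ) (h0 : e 0 = 1) (h : ∀ i, 1 ≤ i → i ≤ k → e i = 2) :
    ∀ j ≤ k, ∀ n, ozH e (j + 1) n = ozP (fun a => 2 * (1 / ((a : ℝ) + 1) ^ (2 * j + 1))) n := by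
  intro j
  induction j with
  | zero =>
    intro _
    apply ozH_eq_of_step
    intro n
    rw [ozP_step _ (fun a => 2 * ((a : ℝ) + 1)), ozP_tele, h0]
    · simp only [ozH]
      push_cast
      have : (n : ℝ) + 1 ≠ 0 := by positivity
      field_simp
    · intro a
      have : (a : ℝ) + 1 ≠ 0 := by positivity
      field_simp
      simp
  | succ j ih =>
    intro hj
    apply ozH_eq_of_step
    intro n
    rw [ozP_step _ (fun a => 2 * (1 / ((a : ℝ) + 1) ^ (2 * j + 1))), h _ (by omega) hj,
      ih (by omega)]
    intro a
    have : (a : ℝ) + 1 ≠ 0 := by positivity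
    field_simp
    try ring

lemma ozH_second (e : ℕ → ℕ) (k : ℕ) (h0 : e 0 = 1) (h : ∀ i, 1 ≤ i → i ≤ k → e i = 2)
    (hk : e (k + 1) = 1) (h2 : ∀ i, k + 2 ≤ i → e i = 2) (j n : ℕ) :
    ozH e (k + j + 2) n = ozP (fun a => 1 / ((a : ℝ) + 1) ^ (2 * j + 1) *
        ozC (fun b => 1 / ((b : ℝ) + 1) ^ (2 * k + 1)) a) n := by
  induction j generalizing n with
  | zero =>
    apply ozH_eq_of_step
    intro n
    rw [ozP_step _ (fun a => ((a : ℝ) + 1) * ozC (fun b => 1 / ((b : ℝ) + 1) ^ (2 * k + 1)) a),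
      ozP_abel]
    · simp only [hk]
      rw [ozH_first e k h0 h k le_rfl]
      push_cast
      have : (n : ℝ) + 1 ≠ 0 := by positivity
      field_simp
    · intro a
      have : (a : ℝ) + 1 ≠ 0 := by positivity
      field_simp
      try ring
  | succ j ih =>
    apply ozH_eq_of_step
    intro n
    rw [ozP_step _ (fun a => 1 / ((a : ℝ) + 1) ^ (2 * j + 1) *
        ozC (fun b => 1 / ((b : ℝ) + 1) ^ (2 * k + 1)) a), h2 _ (by omega)]
    · have := ih (n + 1)
      rw [show k + (j + 1) + 1 = k + j + 2 by ring, this]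
    intro a
    have : (a : ℝ) + 1 ≠ 0 := by positivity
    field_simp
    try ring

lemma hasSum_of_exhaust {ι : Type*} (f : ι → ℝ) (hf : ∀ x, 0 ≤ f x) (s : ℕ → Finset ι)
    (hs : Monotone s) (hs' : ∀ x, ∃ n, x ∈ s n) (L : ℝ)
    (h : Filter.Tendsto (fun n => ∑ x ∈ s n, f x) Filter.atTop (nhds L)) : HasSum f L := by
  have hlim : Filter.Tendsto s Filter.atTop Filter.atTop :=
    Filter.tendsto_atTop_finset_of_monotone hs hs'
  have hmono : Monotone fun n => ∑ x ∈ s n, f x := fun a b hab =>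
    Finset.sum_le_sum_of_subset_of_nonneg (hs hab) fun _ _ _ => hf _
  have hsum : Summable f := by
    refine summable_of_sum_le (c := L) hf fun u => ?_
    obtain ⟨n, hn⟩ := (hlim.eventually (Filter.eventually_ge_atTop u)).exists
    exact (Finset.sum_le_sum_of_subset_of_nonneg hn fun _ _ _ => hf _).trans
      (hmono.ge_of_tendsto h n)
  have h2 := hsum.hasSum.comp hlim
  rw [tendsto_nhds_unique h h2]
  exact hsum.hasSum

/-- Positive integers up to `n`. -/
def ozT (n : ℕ) : Finset ℕ+ := (Finset.range n).map ⟨Nat.succPNat, Nat.succPNat_injective⟩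

lemma mem_ozT (n : ℕ) (x : ℕ+) : x ∈ ozT n ↔ (x : ℕ) ≤ n := by
  simp only [ozT, Finset.mem_map, Finset.mem_range, Function.Embedding.coeFn_mk]
  constructor
  · rintro ⟨a, ha, rfl⟩
    simpa using ha
  · intro h
    exact ⟨x.natPred, by have := x.natPred_add_one; omega, by simp⟩

open Classical in
lemma ozH_eq_sum (e : ℕ → ℕ) (d n : ℕ) :
    ozH e d n = ∑ f ∈ (Fintype.piFinset fun _ : Fin d => ozT n).filter Monotone,
      ∏ i : Fin d, (1 : ℝ) / ((f i : ℕ) : ℝ) ^ e i := by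
  induction d generalizing n with
  | zero =>
    have : (Fintype.piFinset fun _ : Fin 0 => ozT n).filter Monotone = {Fin.elim0} := by
      ext f
      simp only [Finset.mem_filter, Fintype.mem_piFinset, Finset.mem_singleton]
      exact ⟨fun _ => Subsingleton.elim _ _, fun _ => ⟨fun i => i.elim0, fun i => i.elim0⟩⟩
    rw [this]; simp [ozH]
  | succ d ih =>
    have h1 : ozH e (d + 1) n = ∑ m ∈ ozT n, 1 / ((m : ℕ) : ℝ) ^ e d * ozH e d m := by
      simp [ozH, ozT]
    rw [h1]
    simp_rw [ih, Finset.mul_sum]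
    rw [Finset.sum_sigma']
    refine Finset.sum_bij' (fun p _ => (Fin.snoc p.2 p.1 : Fin (d + 1) → ℕ+))
      (fun f _ => ⟨f (Fin.last d), Fin.init f⟩) ?_ ?_ ?_ ?_ ?_
    · rintro ⟨m, f⟩ hp
      simp only [Finset.mem_sigma, Finset.mem_filter, Fintype.mem_piFinset, mem_ozT] at hp ⊢
      obtain ⟨hm, hf, hmono⟩ := hp
      constructor
      · intro i
        refine Fin.lastCases ?_ (fun i => ?_) i
        · simpa using hm
        · simpa using (hf i).trans hm
      · intro i j hij
        induction j using Fin.lastCases with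
        | last =>
          induction i using Fin.lastCases with
          | last => simp
          | cast i => simpa using hf i
        | cast j =>
          induction i using Fin.lastCases with
          | last => exact absurd hij (not_le.mpr (Fin.castSucc_lt_last j))
          | cast i => simpa using hmono (Fin.castSucc_le_castSucc_iff.mp hij)
    · intro f hf
      simp only [Finset.mem_sigma, Finset.mem_filter, Fintype.mem_piFinset, mem_ozT] at hf ⊢
      refine ⟨hf.1 _, fun i => ?_, fun i j hij => ?_⟩
      · exact_mod_cast hf.2 (Fin.le_last _)
      · exact hf.2 (Fin.castSucc_le_castSucc_iff.mpr hij)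
    · rintro ⟨m, f⟩ _
      simp
    · intro f _
      simp
    · rintro ⟨m, f⟩ _
      rw [Fin.prod_univ_castSucc]
      simp [mul_comm]

open Classical in
lemma ozH_hasSum (e : ℕ → ℕ) (d : ℕ) (L : ℝ)
    (h : Filter.Tendsto (ozH e d) Filter.atTop (nhds L)) :
    HasSum (fun m : {f : Fin d → ℕ+ // Monotone f} =>
      ∏ i : Fin d, (1 : ℝ) / ((m.1 i : ℕ) : ℝ) ^ e i) L := by
  refine hasSum_of_exhaust _ (fun x => by positivity)
    (fun n => (Fintype.piFinset fun _ : Fin d => ozT n).subtype Monotone) ?_ ?_ L ?_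
  · intro a b hab x hx
    simp only [Finset.mem_subtype, Fintype.mem_piFinset, mem_ozT] at hx ⊢
    exact fun i => (hx i).trans hab
  · intro x
    refine ⟨∑ i, (x.1 i : ℕ), ?_⟩
    simp only [Finset.mem_subtype, Fintype.mem_piFinset, mem_ozT]
    intro i
    exact Finset.single_le_sum (f := fun i => (x.1 i : ℕ)) (fun _ _ => Nat.zero_le _)
      (Finset.mem_univ i)
  · refine h.congr fun n => ?_
    rw [ozH_eq_sum, Finset.sum_subtype_eq_sum_filter
      (f := fun f : Fin d → ℕ+ => ∏ i : Fin d, (1 : ℝ) / ((f i : ℕ) : ℝ) ^ e i)]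

lemma ozP_tendsto (x : ℕ → ℝ) (hx0 : ∀ a, 0 ≤ x a) (hx : Summable x) :
    Filter.Tendsto (ozP x) Filter.atTop (nhds (∑' a, x a)) := by
  have h : ∀ n, ozP x n = ∑' a, ozW n (a + 1) * x a := by
    intro n
    rw [ozP, tsum_eq_sum]
    intro b hb
    rw [ozW_zero_of_lt n _ (by simp at hb; omega), zero_mul]
  rw [funext h]
  refine tendsto_tsum_of_dominated_convergence hx (fun a => ?_) (.of_forall fun n a => ?_)
  · simpa using (ozW_tendsto (a + 1)).mul_const (x a)
  · have := ozW_bounds n (a + 1)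
    rw [Real.norm_of_nonneg (mul_nonneg this.1 (hx0 a))]
    exact mul_le_of_le_one_left (hx0 a) this.2

lemma oz_summable_inner (k l : ℕ) (hl : 1 ≤ l) :
    Summable fun a : ℕ => 1 / ((a : ℝ) + 1) ^ (2 * l + 1) *
      ∑ b ∈ Finset.range a, 1 / ((b : ℝ) + 1) ^ (2 * k + 1) := by
  have h : Summable fun a : ℕ => 1 / ((a : ℝ) + 1) ^ 2 := by
    have := (summable_nat_add_iff 1).mpr (Real.summable_one_div_nat_pow.mpr (one_lt_two))
    simpa using this
  refine Summable.of_nonneg_of_le (fun a => by positivity) (fun a => ?_) h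
  have h1 : ∑ b ∈ Finset.range a, 1 / ((b : ℝ) + 1) ^ (2 * k + 1) ≤ (a : ℝ) + 1 := by
    have : ∑ b ∈ Finset.range a, 1 / ((b : ℝ) + 1) ^ (2 * k + 1) ≤
        ∑ b ∈ Finset.range a, (1 : ℝ) := by
      refine Finset.sum_le_sum fun b _ => ?_
      rw [div_le_one (by positivity)]
      exact one_le_pow₀ (by linarith [(Nat.cast_nonneg b : (0 : ℝ) ≤ b)])
    simp only [Finset.sum_const, Finset.card_range, nsmul_eq_mul, mul_one] at this
    linarith
  have h2 : ((a : ℝ) + 1) ^ 3 ≤ ((a : ℝ) + 1) ^ (2 * l + 1) :=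
    pow_le_pow_right₀ (by linarith [(Nat.cast_nonneg a : (0 : ℝ) ≤ a)]) (by omega)
  calc _ ≤ 1 / ((a : ℝ) + 1) ^ 3 * ((a : ℝ) + 1) := by gcongr
    _ = _ := by
      have : (a : ℝ) + 1 ≠ 0 := by positivity
      field_simp

open Classical in
lemma oz_hasSum_pairs (k l : ℕ) (hl : 1 ≤ l) :
    HasSum (fun p : {p : ℕ+ × ℕ+ // p.1 < p.2} =>
      (1 : ℝ) / ((((p.1.1 : ℕ) : ℝ)) ^ (2 * k + 1) * (((p.1.2 : ℕ) : ℝ)) ^ (2 * l + 1)))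
      (∑' a : ℕ, 1 / ((a : ℝ) + 1) ^ (2 * l + 1) *
        ∑ b ∈ Finset.range a, 1 / ((b : ℝ) + 1) ^ (2 * k + 1)) := by
  refine hasSum_of_exhaust _ (fun x => by positivity)
    (fun n => (ozT n ×ˢ ozT n).subtype (fun p => p.1 < p.2)) ?_ ?_ _ ?_
  · intro a b hab x hx
    simp only [Finset.mem_subtype, Finset.mem_product, mem_ozT] at hx ⊢
    exact ⟨hx.1.trans hab, hx.2.trans hab⟩
  · intro x
    refine ⟨(x.1.1 : ℕ) + x.1.2, ?_⟩
    simp only [Finset.mem_subtype, Finset.mem_product, mem_ozT]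
    omega
  · refine ((oz_summable_inner k l hl).hasSum.tendsto_sum_nat).congr fun n => ?_
    rw [Finset.sum_subtype_eq_sum_filter (f := fun p : ℕ+ × ℕ+ =>
      (1 : ℝ) / ((((p.1 : ℕ) : ℝ)) ^ (2 * k + 1) * (((p.2 : ℕ) : ℝ)) ^ (2 * l + 1)))]
    simp_rw [Finset.mul_sum]
    rw [Finset.sum_sigma']
    refine Finset.sum_bij' (fun p _ => (Nat.succPNat p.2, Nat.succPNat p.1))
      (fun p _ => ⟨p.2.natPred, p.1.natPred⟩) ?_ ?_ ?_ ?_ ?_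
    · rintro ⟨a, b⟩ hp
      simp only [Finset.mem_sigma, Finset.mem_range, Finset.mem_filter, Finset.mem_product,
        mem_ozT, Nat.succPNat_coe, Nat.succPNat_lt_succPNat] at hp ⊢
      omega
    · rintro ⟨a, b⟩ hp
      simp only [Finset.mem_sigma, Finset.mem_range, Finset.mem_filter, Finset.mem_product,
        mem_ozT, ← PNat.coe_lt_coe] at hp ⊢
      have h1 := a.natPred_add_one
      have h2 := b.natPred_add_one
      omega
    · rintro ⟨a, b⟩ _
      simp
    · rintro ⟨a, b⟩ _
      simp
    · rintro ⟨a, b⟩ _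
      simp [mul_comm]

/-- ζ*(1,{2}^k,1,{2}^l) = 4 ζ(2k+1,2l+1) + 2 ζ(2k+2l+2) for k ≥ 0, l > 0. -/
theorem ohno_zudilin_depth_two (k l : ℕ) (hl : 1 ≤ l) :
    (∑' m : {f : Fin (k + l + 2) → ℕ+ // Monotone f},
      ∏ i : Fin (k + l + 2), (1 : ℝ) /
        (((m.1 i : ℕ) : ℝ)) ^ (if (i : ℕ) = 0 ∨ (i : ℕ) = k + 1 then 1 else 2))
    = 4 * (∑' p : {p : ℕ+ × ℕ+ // p.1 < p.2},
        (1 : ℝ) / ((((p.1.1 : ℕ) : ℝ)) ^ (2 * k + 1) * (((p.1.2 : ℕ) : ℝ)) ^ (2 * l + 1)))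
      + 2 * ∑' n : ℕ+, (1 : ℝ) / (((n : ℕ) : ℝ)) ^ (2 * k + 2 * l + 2) := by
  have hS := oz_summable_inner k l hl
  have hD : Summable fun a : ℕ => 1 / ((a : ℝ) + 1) ^ (2 * k + 2 * l + 2) := by
    have := (summable_nat_add_iff 1).mpr
      (Real.summable_one_div_nat_pow.mpr (show 1 < 2 * k + 2 * l + 2 by omega))
    simpa using this
  have hsplit : ∀ a : ℕ, 1 / ((a : ℝ) + 1) ^ (2 * l + 1) *
        ozC (fun b => 1 / ((b : ℝ) + 1) ^ (2 * k + 1)) a =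
      4 * (1 / ((a : ℝ) + 1) ^ (2 * l + 1) *
        ∑ b ∈ Finset.range a, 1 / ((b : ℝ) + 1) ^ (2 * k + 1)) +
      2 * (1 / ((a : ℝ) + 1) ^ (2 * k + 2 * l + 2)) := by
    intro a
    have h : 1 / ((a : ℝ) + 1) ^ (2 * k + 2 * l + 2) =
        1 / ((a : ℝ) + 1) ^ (2 * l + 1) * (1 / ((a : ℝ) + 1) ^ (2 * k + 1)) := by
      rw [one_div_mul_one_div, ← pow_add]; congr 2; omega
    rw [h, ozC]; ring
  have hX := (hS.mul_left 4).add (hD.mul_left 2)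
  rw [← funext hsplit] at hX
  have hlim := ozP_tendsto _ (fun a => by
    have : 0 ≤ ozC (fun b : ℕ => 1 / ((b : ℝ) + 1) ^ (2 * k + 1)) a := by
      unfold ozC; positivity
    positivity) hX
  have hH := ozH_second (fun i => if i = 0 ∨ i = k + 1 then 1 else 2) k (by simp)
    (fun i h1 h2 => if_neg (by omega)) (by simp) (fun i h => if_neg (by omega)) l
  rw [← funext hH] at hlim
  have hfin := ozH_hasSum _ _ _ hlim
  rw [hfin.tsum_eq, (oz_hasSum_pairs k l hl).tsum_eq, funext hsplit,
    (hS.mul_left 4).tsum_add (hD.mul_left 2), tsum_mul_left, tsum_mul_left,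
    tsum_pnat_eq_tsum_succ (f := fun n : ℕ => (1 : ℝ) / (n : ℝ) ^ (2 * k + 2 * l + 2))]
  simp
end

section
/- (Zhao's 2-1 formula) For integers d ≥ 1, l₁,…,l_{d-1} ≥ 0 and l_d > 0, the multiple zeta star value of index (1,{2}^{l₁}, 1,{2}^{l₂}, …, 1,{2}^{l_d}) equals ∑_{0 < m₁ ≤ m₂ ≤ ⋯ ≤ m_d} 2^{#{m₁,…,m_d}} / (m₁^{2l₁+1} m₂^{2l₂+1} ⋯ m_d^{2l_d+1}), where #{m₁,…,m_d} is the number of distinct values among m₁,…,m_d. -/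
open scoped BigOperators

namespace ZhaoAux

/-- connector -/
noncomputable def C (n k : ℕ) : ℝ := ∏ i ∈ Finset.range k, ((n : ℝ) - i) / (n + i + 1)

lemma C_zero (n : ℕ) : C n 0 = 1 := by simp [C]

lemma C_succ (n k : ℕ) : C n (k+1) = C n k * (((n : ℝ) - k) / (n + k + 1)) := by
  rw [C, Finset.prod_range_succ, C]

lemma C_big {n k : ℕ} (h : n < k) : C n k = 0 := by
  apply Finset.prod_eq_zero (Finset.mem_range.2 h); simp

lemma C_nonneg (n k : ℕ) : 0 ≤ C n k := by
  rcases lt_or_ge n k with h | h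
  · rw [C_big h]
  · apply Finset.prod_nonneg
    intro i hi
    have : (i : ℝ) ≤ n := by exact_mod_cast (Finset.mem_range.1 hi).le.trans h
    apply div_nonneg <;> [linarith; positivity]

lemma C_diff (n k : ℕ) : C n k * ((n : ℝ) + 1)^2 = C (n+1) k * (((n:ℝ)+1)^2 - k^2) := by
  induction k with
  | zero => simp [C_zero]
  | succ k ih =>
    rw [C_succ, C_succ]
    have h1 : (n : ℝ) + k + 1 ≠ 0 := by positivity
    have h2 : (n : ℝ) + 1 + k + 1 ≠ 0 := by positivity
    have : C n k * (((n:ℝ) - k) / (n + k + 1)) * ((n:ℝ)+1)^2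
        = (C n k * ((n : ℝ) + 1)^2) * (((n:ℝ) - k) / (n + k + 1)) := by ring
    rw [this, ih]
    push_cast
    field_simp
    ring

lemma C_diff' (n k : ℕ) : C (n+1) k - C n k = C (n+1) k * k^2 / ((n:ℝ)+1)^2 := by
  have h := C_diff n k
  have h1 : (n : ℝ) + 1 ≠ 0 := by positivity
  field_simp
  linarith

lemma C_mono (k : ℕ) : Monotone (fun n => C n k) := by
  apply monotone_nat_of_le_succ
  intro n
  have h := C_diff' n k
  have : 0 ≤ C (n+1) k * k^2 / ((n:ℝ)+1)^2 :=
    div_nonneg (mul_nonneg (C_nonneg _ _) (by positivity)) (by positivity)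
  linarith

lemma C_tendsto (k : ℕ) : Filter.Tendsto (fun n => C n k) Filter.atTop (nhds 1) := by
  have : ∀ i ∈ Finset.range k, Filter.Tendsto (fun n : ℕ => ((n : ℝ) - i) / (n + i + 1))
      Filter.atTop (nhds 1) := by
    intro i _
    have h := (tendsto_natCast_div_add_atTop (𝕜 := ℝ) ((i:ℝ)+1))
    have h2 : Filter.Tendsto (fun n : ℕ => (i:ℝ) / ((n:ℝ) + (i + 1))) Filter.atTop (nhds 0) := by
      apply Filter.Tendsto.const_div_atTop
      exact Filter.tendsto_atTop_add_const_right _ _ tendsto_natCast_atTop_atTop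
    have h3 := h.sub h2
    simp only [sub_zero] at h3
    refine h3.congr (fun n => ?_)
    rw [← sub_div, add_assoc]
  have h := tendsto_finsetProd (Finset.range k) this
  simpa [C] using h

noncomputable def F (a : ℕ → ℝ) (n : ℕ) : ℝ := ∑ k ∈ Finset.range (n+1), a k * C n k

lemma F_diff (a : ℕ → ℝ) (n : ℕ) : F a (n+1) - F a n =
    (∑ k ∈ Finset.range (n+2), a k * k^2 * C (n+1) k) / ((n:ℝ)+1)^2 := by
  have h : F a n = ∑ k ∈ Finset.range (n+2), a k * C n k := by
    rw [Finset.sum_range_succ, C_big (Nat.lt_succ_self n)]; simp [F]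
  rw [h, F, ← Finset.sum_sub_distrib, Finset.sum_div]
  apply Finset.sum_congr rfl
  intro k _
  rw [← mul_sub, C_diff']; ring

lemma F_zero (a : ℕ → ℝ) : F a 0 = a 0 := by simp [F, C_zero]

lemma F_two (a : ℕ → ℝ) (h0 : a 0 = 0) (n : ℕ) :
    F (fun k => a k / (k:ℝ)^2) (n+1) - F (fun k => a k / (k:ℝ)^2) n
      = F a (n+1) / ((n:ℝ)+1)^2 := by
  rw [F_diff, F]
  congr 1
  apply Finset.sum_congr rfl
  intro k _
  rcases Nat.eq_zero_or_pos k with rfl | hk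
  · simp [h0]
  · have : (k:ℝ) ≠ 0 := by positivity
    field_simp

lemma abel (a : ℕ → ℝ) (N M : ℕ) :
    ∑ k ∈ Finset.range M, (2 * (∑ j ∈ Finset.range k, a j) + a k) * k * C N k
      = N * ∑ k ∈ Finset.range M, a k * C N k
        - (∑ j ∈ Finset.range M, a j) * ((N:ℝ) + M) * C N M := by
  induction M with
  | zero => simp
  | succ M ih =>
    rw [Finset.sum_range_succ, ih, Finset.sum_range_succ (fun k => a k * C N k),
      Finset.sum_range_succ a, C_succ]
    have h1 : (N : ℝ) + M + 1 ≠ 0 := by positivity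
    push_cast
    field_simp
    ring

lemma F_one (a : ℕ → ℝ) (n : ℕ) :
    F (fun k => (2 * (∑ j ∈ Finset.range k, a j) + a k) / (k:ℝ)) (n+1)
     - F (fun k => (2 * (∑ j ∈ Finset.range k, a j) + a k) / (k:ℝ)) n
      = F a (n+1) / ((n:ℝ)+1) := by
  rw [F_diff]
  have h := abel a (n+1) (n+2)
  rw [C_big (show n + 1 < n + 2 by omega)] at h
  have h2 : ∑ k ∈ Finset.range (n+2),
      (2 * (∑ j ∈ Finset.range k, a j) + a k) / (k:ℝ) * k^2 * C (n+1) k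
      = ∑ k ∈ Finset.range (n+2), (2 * (∑ j ∈ Finset.range k, a j) + a k) * k * C (n+1) k := by
    apply Finset.sum_congr rfl
    intro k _
    rcases Nat.eq_zero_or_pos k with rfl | hk
    · simp
    · have : (k:ℝ) ≠ 0 := by positivity
      field_simp
  rw [h2, h, F]
  have : (n : ℝ) + 1 ≠ 0 := by positivity
  push_cast
  field_simp
  ring

noncomputable def S (e : ℕ → ℕ) : ℕ → ℕ → ℝ
  | 0, _ => 1
  | w+1, n => ∑ i ∈ Finset.range n, S e w (i+1) / ((i:ℝ)+1)^(e w)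

noncomputable def A (L : ℕ → ℕ) : ℕ → ℕ → ℝ
  | 0, k => if k = 0 then 1 else 0
  | d+1, k => (2 * (∑ j ∈ Finset.range k, A L d j) + A L d k) / (k:ℝ)^(2 * L d + 1)

lemma S_succ_eq (e : ℕ → ℕ) (w : ℕ) (a b : ℕ → ℝ) (hS : ∀ n, S e w n = F a n)
    (hb : b 0 = 0) (h : ∀ n, F b (n+1) - F b n = F a (n+1) / ((n:ℝ)+1)^(e w)) (n : ℕ) :
    S e (w+1) n = F b n := by
  induction n with
  | zero => simp [S, F_zero, hb]
  | succ n ih =>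
    have : S e (w+1) (n+1) = S e (w+1) n + S e w (n+1) / ((n:ℝ)+1)^(e w) := by
      simp [S, Finset.sum_range_succ]
    rw [this, ih, hS, ← h]; ring

def s (L : ℕ → ℕ) (i : ℕ) : ℕ := i + ∑ j ∈ Finset.range i, L j

lemma s_succ (L : ℕ → ℕ) (i : ℕ) : s L (i+1) = s L i + 1 + L i := by
  simp [s, Finset.sum_range_succ]; ring

lemma s_mono (L : ℕ → ℕ) : StrictMono (s L) := by
  apply strictMono_nat_of_lt_succ
  intro n; rw [s_succ]; omega

open Classical in
noncomputable def E (L : ℕ → ℕ) (p : ℕ) : ℕ := if ∃ i, p = s L i then 1 else 2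

lemma E_one (L : ℕ → ℕ) (i : ℕ) : E L (s L i) = 1 := by
  rw [E, if_pos ⟨i, rfl⟩]

lemma E_two (L : ℕ → ℕ) (i t : ℕ) (h : t < L i) : E L (s L i + 1 + t) = 2 := by
  rw [E, if_neg]
  rintro ⟨j, hj⟩
  have h1 : s L i < s L j := by omega
  have h2 : s L j < s L (i+1) := by rw [s_succ]; omega
  have := (s_mono L).lt_iff_lt.1 h1
  have := (s_mono L).lt_iff_lt.1 h2
  omega

theorem finite_main (L : ℕ → ℕ) (d : ℕ) : ∀ n, S (E L) (s L d) n = F (A L d) n := by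
  induction d with
  | zero =>
    intro n
    simp [s, S, F, A, C_zero]
  | succ d ih =>
    have key : ∀ t, t ≤ L d → ∀ n, S (E L) (s L d + 1 + t) n =
        F (fun k => (2 * (∑ j ∈ Finset.range k, A L d j) + A L d k) / (k:ℝ)^(2 * t + 1)) n := by
      intro t
      induction t with
      | zero =>
        intro _
        apply S_succ_eq _ _ (A L d) _ ih
        · simp
        · intro n
          have := F_one (A L d) n
          rw [E_one]
          simpa using this
      | succ t iht =>
        intro ht
        apply S_succ_eq _ _ _ _ (iht (by omega))
        · simp
        · intro n
          have := F_two (fun k => (2 * (∑ j ∈ Finset.range k, A L d j) + A L d k)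
            / (k:ℝ)^(2 * t + 1)) (by simp) n
          rw [E_two L d t (by omega), ← this]
          simp only [div_div, ← pow_add]
          rfl
    intro n
    rw [s_succ, key _ le_rfl n]
    rfl

lemma A_nonneg (L : ℕ → ℕ) (d k : ℕ) : 0 ≤ A L d k := by
  induction d generalizing k with
  | zero => simp only [A]; split_ifs <;> norm_num
  | succ d ih =>
    simp only [A]
    have := Finset.sum_nonneg (fun j (_ : j ∈ Finset.range k) => ih j)
    have := ih k
    positivity

lemma S_nonneg (e : ℕ → ℕ) (w n : ℕ) : 0 ≤ S e w n := by
  induction w generalizing n with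
  | zero => simp [S]
  | succ w ih =>
    simp only [S]
    exact Finset.sum_nonneg (fun j _ => div_nonneg (ih _) (by positivity))

open ENNReal Filter Topology

theorem lim_F (a : ℕ → ℝ) (ha : ∀ k, 0 ≤ a k) :
    Tendsto (fun n => ENNReal.ofReal (F a n)) atTop (𝓝 (∑' k, ENNReal.ofReal (a k))) := by
  have h1 : ∀ n, ENNReal.ofReal (F a n) = ∑' k, ENNReal.ofReal (a k * C n k) := by
    intro n
    rw [F, ENNReal.ofReal_sum_of_nonneg (fun k _ => mul_nonneg (ha k) (C_nonneg _ _)),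
      tsum_eq_sum]
    intro k hk
    rw [C_big (by simpa using hk)]; simp
  simp only [h1]
  simp only [← MeasureTheory.lintegral_count]
  apply MeasureTheory.lintegral_tendsto_of_tendsto_of_monotone
  · intro n; exact (measurable_of_countable _).aemeasurable
  · refine Eventually.of_forall (fun k n m hnm => ?_)
    exact ENNReal.ofReal_le_ofReal (mul_le_mul_of_nonneg_left (C_mono k hnm) (ha k))
  · refine Eventually.of_forall (fun k => ?_)
    apply ENNReal.tendsto_ofReal
    simpa using (C_tendsto k).const_mul (a k)

/-- bounded star sums -/
lemma snoc_mono {w : ℕ} (f : Fin w → ℕ+) (m : ℕ+) :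
    Monotone (Fin.snoc f m : Fin (w+1) → ℕ+) ↔ Monotone f ∧ ∀ p, f p ≤ m := by
  constructor
  · intro h
    refine ⟨fun p q hpq => ?_, fun p => ?_⟩
    · have := h (show p.castSucc ≤ q.castSucc from hpq)
      simpa using this
    · have := h (Fin.le_last p.castSucc)
      simpa using this
  · rintro ⟨h1, h2⟩ p q hpq
    induction q using Fin.lastCases with
    | last =>
      induction p using Fin.lastCases with
      | last => exact le_rfl
      | cast p => simpa using h2 p
    | cast q =>
      induction p using Fin.lastCases with
      | last => exact absurd hpq (not_le.2 (Fin.castSucc_lt_last q))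
      | cast p => simpa using h1 (show p ≤ q from hpq)

lemma tsum_snoc {w : ℕ} (g : (Fin (w+1) → ℕ+) → ℝ≥0∞) :
    ∑' f, g f = ∑' m : ℕ+, ∑' f : Fin w → ℕ+, g (Fin.snoc f m) := by
  rw [← (Fin.snocEquiv (fun _ => ℕ+)).tsum_eq, ENNReal.tsum_prod']
  rfl

lemma tsum_pn (g : ℕ+ → ℝ≥0∞) : ∑' m, g m = ∑' i : ℕ, g i.succPNat := by
  rw [← Equiv.pnatEquivNat.symm.tsum_eq]; rfl

open Classical in
lemma S_eq (e : ℕ → ℕ) (w : ℕ) (n : ℕ) :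
    ∑' f : Fin w → ℕ+, (if Monotone f ∧ ∀ p, (f p : ℕ) ≤ n then
      ENNReal.ofReal (∏ p : Fin w, (1:ℝ) / ((f p : ℕ) : ℝ) ^ e p) else 0)
      = ENNReal.ofReal (S e w n) := by
  induction w generalizing n with
  | zero =>
    rw [tsum_eq_single default (fun b hb => absurd (Subsingleton.elim b _) hb)]
    simp [S, Subsingleton.monotone]
  | succ w ih =>
    rw [tsum_snoc, tsum_pn]
    have h : ∀ i : ℕ, ∑' f : Fin w → ℕ+,
        (if Monotone (Fin.snoc f i.succPNat : Fin (w+1) → ℕ+) ∧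
          ∀ p, ((Fin.snoc f i.succPNat : Fin (w+1) → ℕ+) p : ℕ) ≤ n then
        ENNReal.ofReal (∏ p : Fin (w+1), (1:ℝ) /
          (((Fin.snoc f i.succPNat : Fin (w+1) → ℕ+) p : ℕ) : ℝ) ^ e p) else 0)
        = if i < n then ENNReal.ofReal (S e w (i+1) / ((i:ℝ)+1)^(e w)) else 0 := by
      intro i
      split_ifs with hi
      · rw [div_eq_mul_inv, ENNReal.ofReal_mul (S_nonneg _ _ _), ← ih, ← ENNReal.tsum_mul_right]
        congr 1; ext1 f
        have hc : (Monotone (Fin.snoc f i.succPNat : Fin (w+1) → ℕ+) ∧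
          ∀ p, ((Fin.snoc f i.succPNat : Fin (w+1) → ℕ+) p : ℕ) ≤ n) ↔
            (Monotone f ∧ ∀ p, (f p : ℕ) ≤ i + 1) := by
          rw [snoc_mono, Fin.forall_fin_succ']
          simp only [Fin.snoc_castSucc, Fin.snoc_last, ← PNat.coe_le_coe, Nat.succPNat_coe]
          constructor
          · rintro ⟨⟨h1, h2⟩, _⟩; exact ⟨h1, h2⟩
          · rintro ⟨h1, h2⟩; exact ⟨⟨h1, h2⟩, fun p => (h2 p).trans hi, hi⟩
        simp only [hc]
        split_ifs
        · rw [← ENNReal.ofReal_mul (Finset.prod_nonneg (fun _ _ => by positivity)),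
            Fin.prod_univ_castSucc]
          simp
        · simp
      · rw [ENNReal.tsum_eq_zero]
        intro f
        rw [if_neg]
        rintro ⟨_, h2⟩
        have := h2 (Fin.last w)
        simp at this; omega
    rw [tsum_congr h, tsum_eq_sum (s := Finset.range n)]
    · rw [S, ENNReal.ofReal_sum_of_nonneg
        (fun k _ => div_nonneg (S_nonneg _ _ _) (by positivity))]
      exact Finset.sum_congr rfl (fun i hi => if_pos (Finset.mem_range.1 hi))
    · intro i hi; exact if_neg (by simpa using hi)

open Classical in
lemma LHS_lim (e : ℕ → ℕ) (w : ℕ) :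
    Tendsto (fun n => ENNReal.ofReal (S e w n)) atTop (𝓝
     (∑' f : Fin w → ℕ+, (if Monotone f then
      ENNReal.ofReal (∏ p : Fin w, (1:ℝ) / ((f p : ℕ) : ℝ) ^ e p) else 0))) := by
  cases w with
  | zero =>
    rw [tsum_eq_single default (fun b hb => absurd (Subsingleton.elim b _) hb)]
    simp [S, Subsingleton.monotone]
  | succ w =>
    rw [tsum_snoc, tsum_pn]
    have h : ∀ i : ℕ, ∑' f : Fin w → ℕ+,
        (if Monotone (Fin.snoc f i.succPNat : Fin (w+1) → ℕ+) then
        ENNReal.ofReal (∏ p : Fin (w+1), (1:ℝ) /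
          (((Fin.snoc f i.succPNat : Fin (w+1) → ℕ+) p : ℕ) : ℝ) ^ e p) else 0)
        = ENNReal.ofReal (S e w (i+1) / ((i:ℝ)+1)^(e w)) := by
      intro i
      rw [div_eq_mul_inv, ENNReal.ofReal_mul (S_nonneg _ _ _), ← S_eq, ← ENNReal.tsum_mul_right]
      congr 1; ext1 f
      simp only [snoc_mono, ← PNat.coe_le_coe, Nat.succPNat_coe]
      simp only [Nat.succ_eq_add_one]
      split_ifs
      · rw [← ENNReal.ofReal_mul (Finset.prod_nonneg (fun _ _ => by positivity)),
          Fin.prod_univ_castSucc]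
        simp
      · simp
    rw [tsum_congr h]
    refine (ENNReal.tendsto_nat_tsum _).congr (fun n => ?_)
    rw [S, ENNReal.ofReal_sum_of_nonneg
        (fun k _ => div_nonneg (S_nonneg _ _ _) (by positivity))]

open Classical in
/-- weight on the right-hand side -/
noncomputable def W (L : ℕ → ℕ) (d : ℕ) (f : Fin d → ℕ+) : ℝ≥0∞ :=
  if Monotone f then ENNReal.ofReal ((2 : ℝ) ^ (Finset.univ.image f).card /
          ∏ i : Fin d, (((f i : ℕ) : ℝ)) ^ (2 * L i + 1)) else 0

lemma image_snoc {d : ℕ} (f : Fin d → ℕ+) (k : ℕ+) :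
    Finset.univ.image (Fin.snoc f k : Fin (d+1) → ℕ+) = insert k (Finset.univ.image f) := by
  ext x
  simp only [Finset.mem_image, Finset.mem_univ, true_and, Finset.mem_insert]
  rw [Fin.exists_fin_succ']
  simp [or_comm, eq_comm]

lemma W_snoc (L : ℕ → ℕ) (d : ℕ) (f : Fin d → ℕ+) (j k : ℕ+) :
    W L (d+2) (Fin.snoc (Fin.snoc f j : Fin (d+1) → ℕ+) k)
     = W L (d+1) (Fin.snoc f j) * ENNReal.ofReal
       ((if j < k then 2 else if j = k then 1 else 0) / ((k:ℕ):ℝ)^(2 * L (d+1) + 1)) := by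
  set g : Fin (d+1) → ℕ+ := Fin.snoc f j with hg
  have hl : g (Fin.last d) = j := by simp [hg]
  unfold W
  have hsm := snoc_mono g k
  by_cases hm : Monotone g
  · by_cases hjk : j ≤ k
    · have hall : ∀ p, g p ≤ k := fun p => (hm (Fin.le_last p)).trans (hl ▸ hjk)
      rw [if_pos (hsm.2 ⟨hm, hall⟩), if_pos hm, ← ENNReal.ofReal_mul (by positivity), image_snoc,
        Fin.prod_univ_castSucc]
      congr 1
      rcases hjk.lt_or_eq with h | h
      · rw [if_pos h, Finset.card_insert_of_notMem]
        · simp [pow_succ (2:ℝ) (Finset.image g Finset.univ).card, mul_div_mul_comm]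
        · simp only [Finset.mem_image, Finset.mem_univ, true_and, not_exists]
          intro p hp
          have := hm (Fin.le_last p)
          rw [hl, hp] at this
          exact absurd this (not_le.2 h)
      · subst h
        rw [if_neg (lt_irrefl _), if_pos rfl, Finset.insert_eq_of_mem]
        · simp [div_eq_mul_inv, mul_comm, mul_left_comm]
        · simp only [Finset.mem_image, Finset.mem_univ, true_and]
          exact ⟨_, hl⟩
    · rw [if_neg, if_neg (fun h : j < k => hjk h.le), if_neg (fun h : j = k => hjk h.le)]
      · simp
      · intro h'
        obtain ⟨_, h⟩ := hsm.1 h'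
        exact hjk (hl ▸ h (Fin.last d))
  · rw [if_neg hm, if_neg (fun h => hm (hsm.1 h).1), zero_mul]

lemma A_zero (L : ℕ → ℕ) (d : ℕ) : A L (d+1) 0 = 0 := by simp [A]

lemma A_eq (L : ℕ → ℕ) (d : ℕ) (k : ℕ+) :
    ∑' f : Fin d → ℕ+, W L (d+1) (Fin.snoc f k) = ENNReal.ofReal (A L (d+1) k) := by
  induction d generalizing k with
  | zero =>
    rw [tsum_eq_single default (fun b hb => absurd (Subsingleton.elim b _) hb)]
    have : Finset.univ.image (Fin.snoc (default : Fin 0 → ℕ+) k : Fin 1 → ℕ+) = {k} := by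
      rw [image_snoc]; simp
    rw [W, if_pos ((snoc_mono _ _).2 ⟨Subsingleton.monotone _, fun p => p.elim0⟩), this]
    congr 1
    rw [Fin.prod_univ_castSucc, Fin.snoc_last]
    simp [A]
  | succ d ih =>
    rw [tsum_snoc]
    simp only [W_snoc, ENNReal.tsum_mul_right, ih]
    rw [tsum_pn]
    have hk : (k:ℕ) = k.natPred + 1 := (PNat.natPred_add_one k).symm
    rw [tsum_eq_sum (s := Finset.range k)]
    · simp_rw [← ENNReal.ofReal_mul (A_nonneg _ _ _)]
      rw [← ENNReal.ofReal_sum_of_nonneg]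
      · congr 1
        conv_rhs => rw [A]
        rw [hk, Finset.sum_range_succ, Finset.sum_range_succ', A_zero, ← hk]
        have e1 : ∀ i ∈ Finset.range k.natPred, A L (d+1) (i.succPNat : ℕ) *
            ((if i.succPNat < k then 2 else if i.succPNat = k then 1 else 0)
              / ((k:ℕ):ℝ)^(2 * L (d+1) + 1))
            = 2 * A L (d+1) (i+1) / ((k:ℕ):ℝ)^(2 * L (d+1) + 1) := by
          intro i hi
          rw [if_pos]
          · rw [Nat.succPNat_coe]; ring
          · rw [← PNat.coe_lt_coe, hk, Nat.succPNat_coe]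
            have := Finset.mem_range.1 hi
            omega
        rw [Finset.sum_congr rfl e1, PNat.succPNat_natPred, ← Finset.sum_div, ← Finset.mul_sum]
        simp only [lt_irrefl, if_false, if_true]
        ring
      · intro i _
        apply mul_nonneg (A_nonneg _ _ _)
        split_ifs <;> positivity
    · intro i hi
      rw [if_neg, if_neg]
      · simp
      · intro h; rw [← h] at hi; simp at hi
      · intro h; rw [← PNat.coe_lt_coe] at h; simp at h hi; omega

lemma RHS_eq (L : ℕ → ℕ) (d : ℕ) :
    ∑' f : Fin (d+1) → ℕ+, W L (d+1) f = ∑' k, ENNReal.ofReal (A L (d+1) k) := by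
  rw [tsum_snoc]
  simp only [A_eq]
  rw [tsum_pn, tsum_eq_zero_add' (f := fun k => ENNReal.ofReal (A L (d+1) k)) ENNReal.summable,
    A_zero]
  simp

open Classical in
lemma real_tsum {w : ℕ} (g : (Fin w → ℕ+) → ℝ) (hg : ∀ f, 0 ≤ g f) :
    ∑' m : {f : Fin w → ℕ+ // Monotone f}, g m.1
     = (∑' f : Fin w → ℕ+, if Monotone f then ENNReal.ofReal (g f) else 0).toReal := by
  have h : ∑' f : Fin w → ℕ+, (if Monotone f then ENNReal.ofReal (g f) else 0)
      = ∑' m : {f : Fin w → ℕ+ // Monotone f}, ENNReal.ofReal (g m.1) := by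
    have := tsum_subtype {f : Fin w → ℕ+ | Monotone f} (fun f => ENNReal.ofReal (g f))
    refine Eq.trans ?_ this.symm
    refine tsum_congr (fun f => ?_)
    simp [Set.indicator]
  rw [h, ENNReal.tsum_toReal_eq (fun _ => ENNReal.ofReal_ne_top)]
  exact tsum_congr (fun m => (ENNReal.toReal_ofReal (hg _)).symm)

end ZhaoAux

open ZhaoAux in
/-- Zhao's 2-1 formula: ζ*(1,{2}^{l₁},…,1,{2}^{l_d})
    = ∑_{0<m₁≤⋯≤m_d} 2^{#{m₁,…,m_d}} / ∏ m_i^{2l_i+1}. -/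
theorem zhao_two_one (d : ℕ) (hd : 1 ≤ d) (l : Fin d → ℕ)
    (hlast : 0 < l ⟨d - 1, Nat.sub_lt hd Nat.one_pos⟩) :
    (∑' m : {f : Fin (d + ∑ i, l i) → ℕ+ // Monotone f},
      ∏ p : Fin (d + ∑ i, l i), (1 : ℝ) / (((m.1 p : ℕ) : ℝ)) ^
        (if ∃ i : Fin d, (p : ℕ) = (i : ℕ) + ∑ j : Fin d, (if j < i then l j else 0)
          then 1 else 2))
    = ∑' m : {f : Fin d → ℕ+ // Monotone f},
        (2 : ℝ) ^ (Finset.univ.image m.1).card /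
          ∏ i : Fin d, (((m.1 i : ℕ) : ℝ)) ^ (2 * l i + 1) := by
  classical
  set L : ℕ → ℕ := fun i => if h : i < d then l ⟨i, h⟩ else 0 with hL
  have hLl : ∀ i : Fin d, L i = l i := fun i => by simp [hL]
  have hs : ∀ i : Fin d, (i : ℕ) + ∑ j : Fin d, (if j < i then l j else 0) = s L i := by
    intro i
    rw [s]
    congr 1
    have h1 : ∑ j : Fin d, (if j < i then l j else 0)
        = ∑ j : Fin d, (fun j : ℕ => if j < i then L j else 0) j :=
      Finset.sum_congr rfl (fun j _ => by simp [hLl])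
    rw [h1, Fin.sum_univ_eq_sum_range (fun j : ℕ => if j < i then L j else 0) d,
      ← Finset.sum_filter]
    apply Finset.sum_congr _ (fun _ _ => rfl)
    ext x
    have := i.2
    simp only [Finset.mem_filter, Finset.mem_range]
    omega
  have hsd : d + ∑ i, l i = s L d := by
    rw [s, ← Fin.sum_univ_eq_sum_range]
    simp [hLl]
  have hE : ∀ p : Fin (d + ∑ i, l i),
      (if ∃ i : Fin d, (p : ℕ) = (i : ℕ) + ∑ j : Fin d, (if j < i then l j else 0)
          then 1 else 2) = E L p := by
    intro p
    rw [E]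
    have : (∃ i : Fin d, (p : ℕ) = (i : ℕ) + ∑ j : Fin d, (if j < i then l j else 0))
        ↔ ∃ i, (p:ℕ) = s L i := by
      simp only [hs]
      constructor
      · rintro ⟨i, hi⟩; exact ⟨i, hi⟩
      · rintro ⟨i, hi⟩
        have h2 : s L i < s L d := by rw [← hi, ← hsd]; exact p.2
        exact ⟨⟨i, (s_mono L).lt_iff_lt.1 h2⟩, hi⟩
    simp only [this]
  simp only [hE]
  rw [real_tsum (fun f => ∏ p : Fin (d + ∑ i, l i), (1 : ℝ) / (((f p : ℕ) : ℝ)) ^ (E L p))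
      (fun f => Finset.prod_nonneg (fun _ _ => by positivity)),
    real_tsum (fun f : Fin d → ℕ+ => (2 : ℝ) ^ (Finset.univ.image f).card /
          ∏ i : Fin d, (((f i : ℕ) : ℝ)) ^ (2 * l i + 1)) (fun f => by positivity)]
  congr 1
  have h1 := LHS_lim (E L) (d + ∑ i, l i)
  rw [hsd] at h1
  simp only [finite_main] at h1
  have h2 := lim_F (A L d) (A_nonneg L d)
  have h3 := tendsto_nhds_unique h1 h2
  rw [← hsd] at h3
  rw [h3]
  obtain ⟨d, rfl⟩ : ∃ d', d = d' + 1 := ⟨d - 1, by omega⟩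
  rw [← RHS_eq]
  refine tsum_congr (fun f => ?_)
  simp only [W, hLl]
end

section
/- Let n ≥ 2 and let y₁,…,y_n ∈ {0,1} with y₁ = 1 and y_n = 0. Then the value of the convergent series S(β) = ∑_{m₁=0}^∞ ∑_{m₂=m₁+y₁}^∞ ⋯ ∑_{m_n=m_{n-1}+y_{n-1}}^∞ β / ( (m_n+β) · ∏_{j=1}^n (m_j + β·y_j) ) is the same for all real β > 0; moreover its common value equals ∑_{m₁ ≥ y₁, m₂ ≥ m₁+y₂, …, m_{n-1} ≥ m_{n-2}+y_{n-1}} 1/(m₁ m₂ ⋯ m_{n-2} · m_{n-1}²), the limit of S(β) as β → 0⁺. -/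
open scoped BigOperators

namespace HurwitzAux

open Filter Topology

/-- The connector (divided by `β`). -/
noncomputable def e (β : ℝ) (k : ℕ) : ℕ → ℝ
  | 0 => 1 / ((k : ℝ) + β)
  | p + 1 => e β k p * ((β + p + 1) / ((k : ℝ) + β + p + 1))

lemma e_nonneg {β : ℝ} (hβ : 0 ≤ β) (k p : ℕ) : 0 ≤ e β k p := by
  induction p with
  | zero => simp only [e]; positivity
  | succ p ih => simp only [e]; positivity

lemma e_rel {β : ℝ} (hβ : 0 ≤ β) (k p : ℕ) (hk : 0 < (k : ℝ) + β) :
    e β (k + 1) p * ((k : ℝ) + β + p + 1) = e β k p * ((k : ℝ) + β) := by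
  induction p with
  | zero =>
    simp only [e]
    push_cast
    have h1 : (k : ℝ) + 1 + β ≠ 0 := by positivity
    have h2 : (k : ℝ) + β ≠ 0 := hk.ne'
    field_simp
    ring
  | succ p ih =>
    simp only [e]
    push_cast
    have hp : (0 : ℝ) ≤ p := Nat.cast_nonneg p
    have h1 : (k : ℝ) + 1 + β + p + 1 ≠ 0 := by positivity
    have h2 : (k : ℝ) + β + p + 1 ≠ 0 := by positivity
    have e1 : e β (k + 1) p * ((β + p + 1) / ((k : ℝ) + 1 + β + p + 1)) *
        ((k : ℝ) + β + (p + 1) + 1) = e β (k + 1) p * (β + p + 1) := by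
      field_simp
      ring
    have e2 : e β k p * ((β + p + 1) / ((k : ℝ) + β + p + 1)) * ((k : ℝ) + β)
        = (e β k p * ((k : ℝ) + β)) * (β + p + 1) / ((k : ℝ) + β + p + 1) := by
      ring
    rw [e1, e2, ← ih]
    field_simp

lemma e_H1 {β : ℝ} (hβ : 0 ≤ β) (k p : ℕ) (hk : 0 < (k : ℝ) + β) :
    1 / ((k : ℝ) + β) * e β (k + 1) p =
      1 / ((p : ℝ) + 1) * (e β k p - e β (k + 1) p) := by
  have h := e_rel hβ k p hk
  have h2 : (k : ℝ) + β ≠ 0 := hk.ne'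
  have h3 : (p : ℝ) + 1 ≠ 0 := by positivity
  field_simp
  linear_combination h

lemma e_H2 {β : ℝ} (hβ : 0 ≤ β) (k p : ℕ) (hk : 0 < k) :
    1 / ((k : ℝ) + β) * e β (k + 1) p =
      1 / (k : ℝ) * (e β k p - e β k (p + 1)) := by
  have hk' : (0 : ℝ) < k := by exact_mod_cast hk
  have h := e_rel hβ k p (by positivity)
  have h2 : (k : ℝ) + β ≠ 0 := by positivity
  have h3 : (k : ℝ) + β + p + 1 ≠ 0 := by positivity
  have h4 : e β (k + 1) p = e β k p * ((k : ℝ) + β) / ((k : ℝ) + β + p + 1) := by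
    rw [eq_div_iff h3, h]
  rw [h4]
  simp only [e]
  field_simp
  ring

lemma e_anti_k {β : ℝ} (hβ : 0 ≤ β) (k p : ℕ) (hk : 0 < (k : ℝ) + β) :
    e β (k + 1) p ≤ e β k p := by
  have h := e_H1 hβ k p hk
  have h1 : 0 ≤ 1 / ((k : ℝ) + β) * e β (k + 1) p :=
    mul_nonneg (by positivity) (e_nonneg hβ _ _)
  rw [h] at h1
  have := nonneg_of_mul_nonneg_right h1 (by positivity)
  linarith

lemma e_anti_p {β : ℝ} (hβ : 0 ≤ β) (k p : ℕ) :
    e β k (p + 1) ≤ e β k p := by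
  simp only [e]
  apply mul_le_of_le_one_right (e_nonneg hβ _ _)
  apply div_le_one_of_le₀
  · have : (0 : ℝ) ≤ k := Nat.cast_nonneg k
    linarith
  · positivity

lemma e_one {β : ℝ} (hβ : 0 ≤ β) (p : ℕ) : e β 1 p = 1 / ((p : ℝ) + 1 + β) := by
  induction p with
  | zero => simp [e]
  | succ p ih =>
    simp only [e, ih]
    push_cast
    have h1 : (p : ℝ) + 1 + β ≠ 0 := by positivity
    have h2 : (p : ℝ) + 1 + 1 + β ≠ 0 := by positivity
    have h3 : (1 : ℝ) + β + p + 1 ≠ 0 := by positivity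
    field_simp
    ring

lemma e_zero {β : ℝ} (hβ : 0 < β) (p : ℕ) : e β 0 p = 1 / β := by
  induction p with
  | zero => simp [e]
  | succ p ih =>
    simp only [e, ih]
    have h3 : β + p + 1 ≠ 0 := by positivity
    push_cast
    rw [zero_add, div_self h3, mul_one]

lemma e_le_inv {β : ℝ} (hβ : 0 ≤ β) (k p : ℕ) : e β k p ≤ 1 / ((k : ℝ) + β) := by
  induction p with
  | zero => simp [e]
  | succ p ih => exact (e_anti_p hβ k p).trans ih

lemma e_tendsto_k {β : ℝ} (hβ : 0 ≤ β) (a p : ℕ) :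
    Tendsto (fun i : ℕ => e β (a + i) p) atTop (𝓝 0) := by
  have h : Tendsto (fun i : ℕ => 1 / ((i : ℝ) + 1)) atTop (𝓝 0) :=
    tendsto_one_div_add_atTop_nhds_zero_nat
  rw [← tendsto_add_atTop_iff_nat 1]
  refine squeeze_zero (fun i => e_nonneg hβ _ _) (fun i => ?_) h
  refine (e_le_inv hβ _ _).trans ?_
  apply one_div_le_one_div_of_le (by positivity)
  push_cast
  have : (0 : ℝ) ≤ a := Nat.cast_nonneg a
  linarith

lemma e_le_one {β : ℝ} (hβ : 0 ≤ β) (k p : ℕ) : e β (k + 1) p ≤ e β 1 p := by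
  induction k with
  | zero => simp
  | succ k ih => exact (e_anti_k hβ (k + 1) p (by positivity)).trans ih

lemma e_tendsto_p {β : ℝ} (hβ : 0 ≤ β) (k p : ℕ) (hk : 0 < k) :
    Tendsto (fun i : ℕ => e β k (p + i)) atTop (𝓝 0) := by
  have h : Tendsto (fun i : ℕ => 1 / ((i : ℝ) + 1)) atTop (𝓝 0) :=
    tendsto_one_div_add_atTop_nhds_zero_nat
  refine squeeze_zero (fun i => e_nonneg hβ _ _) (fun i => ?_) h
  obtain ⟨k, rfl⟩ : ∃ j, k = j + 1 := ⟨k - 1, by omega⟩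
  refine (e_le_one hβ _ _).trans ?_
  rw [e_one hβ]
  apply one_div_le_one_div_of_le (by positivity)
  push_cast
  have : (0 : ℝ) ≤ p := Nat.cast_nonneg p
  linarith

lemma tele (u : ℕ → ℝ) (hu : ∀ i, u (i + 1) ≤ u i) (h0 : Tendsto u atTop (𝓝 0)) :
    ∑' i, ENNReal.ofReal (u i - u (i + 1)) = ENNReal.ofReal (u 0) := by
  have hs : HasSum (fun i => u i - u (i + 1)) (u 0) := by
    rw [hasSum_iff_tendsto_nat_of_nonneg (fun i => sub_nonneg.2 (hu i))]
    simp only [Finset.sum_range_sub']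
    simpa using (tendsto_const_nhds (x := u 0)).sub h0
  rw [← ENNReal.ofReal_tsum_of_nonneg (fun i => sub_nonneg.2 (hu i)) hs.summable, hs.tsum_eq]

lemma tsum_ge (a : ℕ) (g : ℕ → ENNReal) :
    ∑' k, (if a ≤ k then g k else 0) = ∑' i, g (a + i) := by
  rw [← Summable.sum_add_tsum_nat_add' (f := fun k => if a ≤ k then g k else 0) (k := a)
    ENNReal.summable]
  rw [Finset.sum_eq_zero, zero_add]
  · refine tsum_congr fun i => ?_
    rw [if_pos (by omega), add_comm]
  · intro i hi
    rw [Finset.mem_range] at hi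
    rw [if_neg (by omega)]

lemma P1 {β : ℝ} (hβ : 0 ≤ β) (a p : ℕ) (ha : 0 < (a : ℝ) + β) :
    ∑' k, (if a ≤ k then ENNReal.ofReal (1 / ((k : ℝ) + β)) *
      ENNReal.ofReal (e β (k + 1) p) else 0) =
    ENNReal.ofReal (1 / ((p : ℝ) + 1)) * ENNReal.ofReal (e β a p) := by
  have hpos : ∀ i : ℕ, 0 < ((a + i : ℕ) : ℝ) + β := by
    intro i
    push_cast
    have : (0 : ℝ) ≤ i := Nat.cast_nonneg i
    linarith
  rw [tsum_ge a (fun k => ENNReal.ofReal (1 / ((k : ℝ) + β)) *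
      ENNReal.ofReal (e β (k + 1) p))]
  have h := tele (fun i => e β (a + i) p) (fun i => e_anti_k hβ (a + i) p (hpos i))
    (e_tendsto_k hβ a p)
  simp only [add_zero] at h
  rw [← h, ← ENNReal.tsum_mul_left]
  refine tsum_congr fun i => ?_
  rw [← ENNReal.ofReal_mul (by have := hpos i; positivity), ← ENNReal.ofReal_mul (by positivity),
    e_H1 hβ _ _ (hpos i)]
  rfl

lemma P2 {β : ℝ} (hβ : 0 ≤ β) (a p : ℕ) (ha : 0 < a) :
    ∑' k, (if a ≤ k then ENNReal.ofReal (1 / (k : ℝ)) *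
      ENNReal.ofReal (e β k p) else 0) =
    ∑' q, (if p ≤ q then ENNReal.ofReal (1 / ((q : ℝ) + 1)) * ENNReal.ofReal (e β a q) else 0)
      := by
  have ha' : (0 : ℝ) < a := by exact_mod_cast ha
  have key : ∀ k, (if a ≤ k then ENNReal.ofReal (1 / (k : ℝ)) *
      ENNReal.ofReal (e β k p) else 0) =
      ∑' i : ℕ, (if a ≤ k then ENNReal.ofReal (1 / ((k : ℝ) + β)) *
        ENNReal.ofReal (e β (k + 1) (p + i)) else 0) := by
    intro k
    by_cases hk : a ≤ k
    · simp only [if_pos hk]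
      have h := tele (fun i => e β k (p + i)) (fun i => e_anti_p hβ k (p + i))
        (e_tendsto_p hβ k p (by omega))
      simp only [add_zero] at h
      rw [← h, ← ENNReal.tsum_mul_left]
      refine tsum_congr fun i => ?_
      rw [← ENNReal.ofReal_mul (by positivity), ← ENNReal.ofReal_mul (by positivity),
        e_H2 hβ k (p + i) (by omega)]
      rfl
    · simp [hk]
  rw [tsum_congr key, ENNReal.tsum_comm,
    tsum_ge p (fun q => ENNReal.ofReal (1 / ((q : ℝ) + 1)) * ENNReal.ofReal (e β a q))]
  exact tsum_congr fun i => P1 hβ a (p + i) (by positivity)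

/-- Summand with indicator. -/
noncomputable def P (β : ℝ) : (n : ℕ) → (Fin n → ℕ) → ℕ → (Fin n → ℕ) → ENNReal
  | 0, _, a, _ => ENNReal.ofReal (e β a 0)
  | n + 1, y, a, f => if a ≤ f 0 then ENNReal.ofReal (1 / ((f 0 : ℝ) + β * (y 0 : ℝ))) *
      P β n (Fin.tail y) (f 0 + y 0) (Fin.tail f) else 0

/-- Dual coefficients. -/
noncomputable def T : (n : ℕ) → (Fin n → ℕ) → ℕ → ENNReal
  | 0, _, p => if p = 0 then 1 else 0
  | n + 1, y, p => if y 0 = 1 then ENNReal.ofReal (1 / ((p : ℝ) + 1)) * T n (Fin.tail y) p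
      else ENNReal.ofReal (1 / ((p : ℝ) + 1)) *
        ∑' q, if q ≤ p then T n (Fin.tail y) q else 0

lemma tsum_P_succ (β : ℝ) (n : ℕ) (y : Fin (n + 1) → ℕ) (a : ℕ) :
    ∑' f, P β (n + 1) y a f = ∑' k : ℕ, if a ≤ k then
      ENNReal.ofReal (1 / ((k : ℝ) + β * (y 0 : ℝ))) *
        ∑' f, P β n (Fin.tail y) (k + y 0) f else 0 := by
  rw [← (Fin.consEquiv (fun _ : Fin (n + 1) => ℕ)).tsum_eq, ENNReal.tsum_prod']
  refine tsum_congr fun k => ?_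
  simp only [Fin.consEquiv, Equiv.coe_fn_mk, P, Fin.cons_zero, Fin.tail_cons]
  by_cases h : a ≤ k
  · simp only [if_pos h]
    rw [ENNReal.tsum_mul_left]
  · simp [h]

lemma step1 {β : ℝ} (hβ : 0 ≤ β) (a : ℕ) (ha : 0 < (a : ℝ) + β) (t : ℕ → ENNReal) :
    (∑' k : ℕ, if a ≤ k then ENNReal.ofReal (1 / ((k : ℝ) + β)) *
        ∑' p, t p * ENNReal.ofReal (e β (k + 1) p) else 0) =
    ∑' p : ℕ, (ENNReal.ofReal (1 / ((p : ℝ) + 1)) * t p) * ENNReal.ofReal (e β a p) := by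
  have h1 : ∀ k : ℕ, (if a ≤ k then ENNReal.ofReal (1 / ((k : ℝ) + β)) *
        ∑' p, t p * ENNReal.ofReal (e β (k + 1) p) else 0) =
      ∑' p, t p * (if a ≤ k then ENNReal.ofReal (1 / ((k : ℝ) + β)) *
        ENNReal.ofReal (e β (k + 1) p) else 0) := by
    intro k
    by_cases h : a ≤ k
    · simp only [if_pos h]
      rw [← ENNReal.tsum_mul_left]
      exact tsum_congr fun p => by ring
    · simp [h]
  rw [tsum_congr h1, ENNReal.tsum_comm]
  refine tsum_congr fun p => ?_
  rw [ENNReal.tsum_mul_left, P1 hβ a p ha]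
  ring

lemma step0 {β : ℝ} (hβ : 0 ≤ β) (a : ℕ) (ha : 0 < a) (t : ℕ → ENNReal) :
    (∑' k : ℕ, if a ≤ k then ENNReal.ofReal (1 / (k : ℝ)) *
        ∑' p, t p * ENNReal.ofReal (e β k p) else 0) =
    ∑' p : ℕ, (ENNReal.ofReal (1 / ((p : ℝ) + 1)) * ∑' q, if q ≤ p then t q else 0) *
      ENNReal.ofReal (e β a p) := by
  have h1 : ∀ k : ℕ, (if a ≤ k then ENNReal.ofReal (1 / (k : ℝ)) *
        ∑' p, t p * ENNReal.ofReal (e β k p) else 0) =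
      ∑' p, t p * (if a ≤ k then ENNReal.ofReal (1 / (k : ℝ)) *
        ENNReal.ofReal (e β k p) else 0) := by
    intro k
    by_cases h : a ≤ k
    · simp only [if_pos h]
      rw [← ENNReal.tsum_mul_left]
      exact tsum_congr fun p => by ring
    · simp [h]
  rw [tsum_congr h1, ENNReal.tsum_comm]
  have h2 : ∀ p : ℕ, (∑' k : ℕ, t p * (if a ≤ k then ENNReal.ofReal (1 / (k : ℝ)) *
        ENNReal.ofReal (e β k p) else 0)) =
      ∑' q : ℕ, (if p ≤ q then t p else 0) *
        (ENNReal.ofReal (1 / ((q : ℝ) + 1)) * ENNReal.ofReal (e β a q)) := by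
    intro p
    rw [ENNReal.tsum_mul_left, P2 hβ a p ha, ← ENNReal.tsum_mul_left]
    refine tsum_congr fun q => ?_
    split_ifs <;> simp
  rw [tsum_congr h2, ENNReal.tsum_comm]
  refine tsum_congr fun q => ?_
  rw [ENNReal.tsum_mul_right]
  ring

lemma main_ind {β : ℝ} (hβ : 0 ≤ β) : ∀ (n : ℕ) (y : Fin n → ℕ) (_ : ∀ j, y j ≤ 1)
    (a : ℕ) (_ : 0 < a),
    ∑' f, P β n y a f = ∑' p, T n y p * ENNReal.ofReal (e β a p) := by
  intro n
  induction n with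
  | zero =>
    intro y hy a ha
    rw [tsum_eq_single (β := ℕ) 0 (by intro p hp; simp [T, hp]), tsum_fintype]
    simp [P, T]
  | succ n ih =>
    intro y hy a ha
    rw [tsum_P_succ]
    have hc : ∀ k : ℕ, (if a ≤ k then
      ENNReal.ofReal (1 / ((k : ℝ) + β * (y 0 : ℝ))) *
        ∑' f, P β n (Fin.tail y) (k + y 0) f else 0) =
        (if a ≤ k then
      ENNReal.ofReal (1 / ((k : ℝ) + β * (y 0 : ℝ))) *
        ∑' p, T n (Fin.tail y) p * ENNReal.ofReal (e β (k + y 0) p) else 0) := by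
      intro k
      by_cases h : a ≤ k
      · simp only [if_pos h]
        rw [ih (Fin.tail y) (fun j => hy _) (k + y 0) (by omega)]
      · simp [h]
    rw [tsum_congr hc]
    have ha' : (0 : ℝ) < a := by exact_mod_cast ha
    have hy0 := hy 0
    rcases (by omega : y 0 = 1 ∨ y 0 = 0) with h | h
    · simp only [T, h, if_true, Nat.cast_one, mul_one]
      exact step1 hβ a (by positivity) _
    · simp only [T, h, Nat.cast_zero, mul_zero, add_zero]
      exact step0 hβ a ha _

lemma P_closed {β : ℝ} (hβ : 0 ≤ β) : ∀ (n : ℕ) (y : Fin (n + 1) → ℕ) (a : ℕ)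
    (f : Fin (n + 1) → ℕ),
    P β (n + 1) y a f = if a ≤ f 0 ∧ (∀ i : Fin (n + 1), ∀ hi : (i : ℕ) + 1 < n + 1,
        f i + y i ≤ f ⟨(i : ℕ) + 1, hi⟩) then
      ENNReal.ofReal (1 / ((((f (Fin.last n) + y (Fin.last n) : ℕ) : ℝ) + β) *
        ∏ j, ((f j : ℝ) + β * (y j : ℝ)))) else 0 := by
  intro n
  induction n with
  | zero =>
    intro y a f
    have : (∀ i : Fin (0 + 1), ∀ hi : (i : ℕ) + 1 < 0 + 1,
        f i + y i ≤ f ⟨(i : ℕ) + 1, hi⟩) := by intro i hi; omega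
    by_cases h : a ≤ f 0
    · rw [if_pos ⟨h, this⟩]
      simp only [P, if_pos h, e]
      rw [← ENNReal.ofReal_mul (by positivity)]
      congr 1
      simp
    · rw [if_neg (fun h' => h h'.1)]
      simp only [P, if_neg h]
  | succ n ih =>
    intro y a f
    rw [P, ih]
    have hiff : (∀ i : Fin (n + 1 + 1), ∀ hi : (i : ℕ) + 1 < n + 1 + 1,
        f i + y i ≤ f ⟨(i : ℕ) + 1, hi⟩) ↔
        (f 0 + y 0 ≤ Fin.tail f 0 ∧ (∀ i : Fin (n + 1), ∀ hi : (i : ℕ) + 1 < n + 1,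
        Fin.tail f i + Fin.tail y i ≤ Fin.tail f ⟨(i : ℕ) + 1, hi⟩)) := by
      constructor
      · intro h
        exact ⟨h 0 (by simp), fun i hi => h i.succ (by simpa using hi)⟩
      · rintro ⟨h0, h⟩ i hi
        induction i using Fin.cases with
        | zero => exact h0
        | succ i => exact h i (by simpa using hi)
    by_cases h1 : a ≤ f 0
    · rw [if_pos h1]
      by_cases h2 : (f 0 + y 0 ≤ Fin.tail f 0 ∧ (∀ i : Fin (n + 1), ∀ hi : (i : ℕ) + 1 < n + 1,
        Fin.tail f i + Fin.tail y i ≤ Fin.tail f ⟨(i : ℕ) + 1, hi⟩))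
      · rw [if_pos h2, if_pos ⟨h1, hiff.2 h2⟩]
        rw [← ENNReal.ofReal_mul (by positivity), Fin.prod_univ_succ (n := n + 1)]
        congr 1
        have e1 : Fin.tail f (Fin.last n) = f (Fin.last (n + 1)) := rfl
        have e2 : Fin.tail y (Fin.last n) = y (Fin.last (n + 1)) := rfl
        rw [e1, e2]
        simp only [Fin.tail, one_div, mul_inv]
        ring
      · rw [if_neg h2, if_neg (fun h' => h2 (hiff.1 h'.2)), mul_zero]
    · rw [if_neg h1, if_neg (fun h' => h1 h'.1)]

end HurwitzAux

open HurwitzAux in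
/-- Hurwitz-type series theorem: the nested series S(β) has the same value for all
β > 0, namely the multiple-zeta-type series (the limit as β → 0⁺). -/
theorem hurwitz_type_series (n : ℕ) (hn : 2 ≤ n) (y : Fin n → ℕ)
    (hy : ∀ j, y j ≤ 1)
    (hy0 : y ⟨0, by omega⟩ = 1)
    (hyl : y ⟨n - 1, by omega⟩ = 0)
    (β : ℝ) (hβ : 0 < β) :
    (∑' m : {f : Fin n → ℕ // ∀ i : Fin n, ∀ hi : (i : ℕ) + 1 < n,
        f i + y i ≤ f ⟨(i : ℕ) + 1, hi⟩},
      β / (((m.1 ⟨n - 1, by omega⟩ : ℝ) + β) *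
        ∏ j : Fin n, ((m.1 j : ℝ) + β * (y j : ℝ))))
    = ∑' m : {f : Fin (n - 1) → ℕ //
        y ⟨0, by omega⟩ ≤ f ⟨0, by omega⟩ ∧
        ∀ i : Fin (n - 1), ∀ hi : (i : ℕ) + 1 < n - 1,
          f i + y ⟨(i : ℕ) + 1, by omega⟩ ≤ f ⟨(i : ℕ) + 1, hi⟩},
      (1 : ℝ) / ((∏ i : Fin (n - 1), (m.1 i : ℝ)) * (m.1 ⟨n - 2, by omega⟩ : ℝ)) := by
  obtain ⟨N, rfl⟩ : ∃ N, n = N + 2 := ⟨n - 2, by omega⟩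
  have hy0' : y 0 = 1 := hy0
  have hyl' : y (Fin.last (N + 1)) = 0 := hyl
  have hyt : Fin.tail y (Fin.last N) = 0 := hyl
  -- the two sums in `ENNReal`
  have hL : ∑' f, P β (N + 2) y 0 f =
      ∑' p : ℕ, (ENNReal.ofReal (1 / ((p : ℝ) + 1)) * T (N + 1) (Fin.tail y) p) *
        ENNReal.ofReal (1 / β) := by
    rw [tsum_P_succ]
    have := step1 hβ.le 0 (by simpa using hβ) (T (N + 1) (Fin.tail y))
    simp only [e_zero hβ] at this
    rw [← this]
    refine tsum_congr fun k => ?_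
    rw [main_ind hβ.le (N + 1) (Fin.tail y) (fun j => hy _) (k + y 0) (by omega), hy0']
    simp
  have hR : ∑' f, P 0 (N + 1) (Fin.tail y) (y 0) f =
      ∑' p : ℕ, (ENNReal.ofReal (1 / ((p : ℝ) + 1)) * T (N + 1) (Fin.tail y) p) := by
    rw [hy0', main_ind le_rfl (N + 1) (Fin.tail y) (fun j => hy _) 1 one_pos]
    refine tsum_congr fun p => ?_
    rw [e_one le_rfl, add_zero, mul_comm]
  have hE : ENNReal.ofReal β * ∑' f, P β (N + 2) y 0 f =
      ∑' f, P 0 (N + 1) (Fin.tail y) (y 0) f := by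
    rw [hL, hR, ENNReal.tsum_mul_right, mul_comm, mul_assoc, ← ENNReal.ofReal_mul (by positivity)]
    rw [one_div, inv_mul_cancel₀ hβ.ne', ENNReal.ofReal_one, mul_one]
  have cL : (∑' m : {f : Fin (N + 2) → ℕ // ∀ i : Fin (N + 2), ∀ hi : (i : ℕ) + 1 < N + 2,
        f i + y i ≤ f ⟨(i : ℕ) + 1, hi⟩},
      ENNReal.ofReal (β / (((m.1 (Fin.last (N + 1)) : ℝ) + β) *
        ∏ j : Fin (N + 2), ((m.1 j : ℝ) + β * (y j : ℝ))))) =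
      ENNReal.ofReal β * ∑' f, P β (N + 2) y 0 f := by
    rw [← ENNReal.tsum_mul_left]
    refine (tsum_subtype {f : Fin (N + 2) → ℕ | ∀ i : Fin (N + 2), ∀ hi : (i : ℕ) + 1 < N + 2,
        f i + y i ≤ f ⟨(i : ℕ) + 1, hi⟩} (fun f => ENNReal.ofReal (β /
        (((f (Fin.last (N + 1)) : ℝ) + β) *
        ∏ j : Fin (N + 2), ((f j : ℝ) + β * (y j : ℝ)))))).trans ?_
    refine tsum_congr fun f => ?_
    rw [P_closed hβ.le, hyl', Set.indicator_apply]
    simp only [Set.mem_ofPred_eq, zero_le, true_and, add_zero]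
    split_ifs
    · rw [← ENNReal.ofReal_mul hβ.le, mul_one_div]
    · simp
  have cR : (∑' m : {f : Fin (N + 1) → ℕ // y 0 ≤ f 0 ∧
        ∀ i : Fin (N + 1), ∀ hi : (i : ℕ) + 1 < N + 1,
        f i + Fin.tail y i ≤ f ⟨(i : ℕ) + 1, hi⟩},
      ENNReal.ofReal (1 / ((∏ i : Fin (N + 1), (m.1 i : ℝ)) * (m.1 (Fin.last N) : ℝ)))) =
      ∑' f, P 0 (N + 1) (Fin.tail y) (y 0) f := by
    refine (tsum_subtype {f : Fin (N + 1) → ℕ | y 0 ≤ f 0 ∧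
        ∀ i : Fin (N + 1), ∀ hi : (i : ℕ) + 1 < N + 1,
        f i + Fin.tail y i ≤ f ⟨(i : ℕ) + 1, hi⟩} (fun f => ENNReal.ofReal (1 /
        ((∏ i : Fin (N + 1), (f i : ℝ)) * (f (Fin.last N) : ℝ))))).trans ?_
    refine tsum_congr fun f => ?_
    rw [P_closed le_rfl, hyt, Set.indicator_apply]
    simp only [Set.mem_ofPred_eq, add_zero, zero_mul]
    rw [mul_comm]
  have hfin := congrArg ENNReal.toReal (cL.trans (hE.trans cR.symm))
  rw [ENNReal.tsum_toReal_eq (fun _ => ENNReal.ofReal_ne_top),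
    ENNReal.tsum_toReal_eq (fun _ => ENNReal.ofReal_ne_top)] at hfin
  refine Eq.trans (tsum_congr fun m => ?_) (hfin.trans (tsum_congr fun m => ?_))
  · rw [ENNReal.toReal_ofReal (by positivity)]
    rfl
  · rw [ENNReal.toReal_ofReal (by positivity)]
    rfl
end

section
/- Let n ≥ 2 and y₁,…,y_n ∈ {0,1} with y₁ = 1 and y_n = 0. Then (1/2) · ∑_{m₁=0}^∞ ∑_{m₂=m₁+y₁}^∞ ⋯ ∑_{m_n=m_{n-1}+y_{n-1}}^∞ 1 / ( (m_n + 1/2) · ∏_{j=1}^n (m_j + y_j/2) ) = ∑_{m₁ ≥ y₁, m₂ ≥ m₁+y₂, …, m_{n-1} ≥ m_{n-2}+y_{n-1}} 1/(m₁ m₂ ⋯ m_{n-2} · m_{n-1}²). -/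
open scoped BigOperators

noncomputable def haA : ℕ → ℝ
  | 0 => 1
  | k + 1 => haA k * ((k : ℝ) + 1 / 2) / ((k : ℝ) + 1)

lemma haA_succ (k : ℕ) : haA (k + 1) = haA k * ((k : ℝ) + 1 / 2) / ((k : ℝ) + 1) := rfl

lemma haA_pos (k : ℕ) : 0 < haA k := by
  induction k with
  | zero => simp [haA]
  | succ k ih => simp only [haA]; positivity

/-- shifted coefficient -/
noncomputable def haB (l M : ℕ) : ℝ := if l ≤ M then haA (M - l) else 0

lemma haB_nonneg (l M : ℕ) : 0 ≤ haB l M := by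
  unfold haB; split_ifs
  · exact (haA_pos _).le
  · exact le_rfl

lemma haB_succ (l M : ℕ) : haB (l + 1) (M + 1) = haB l M := by
  simp [haB]

noncomputable def haL (l M : ℕ) : ℝ := haB l M / haA M

lemma haL_nonneg (l M : ℕ) : 0 ≤ haL l M := div_nonneg (haB_nonneg _ _) (haA_pos _).le

lemma haL_zero {l M : ℕ} (h : M < l) : haL l M = 0 := by
  simp [haL, haB, Nat.not_le.2 h]

lemma haKey (l M : ℕ) (hl : 1 ≤ l) :
    (haL l (M + 1) - haL l M) / l =
      (haB l (M + 1) - haB (l + 1) (M + 1)) / (((M : ℝ) + 1) * haA (M + 1)) := by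
  rw [haB_succ]
  have hl' : (0 : ℝ) < l := by exact_mod_cast hl
  have hM := haA_pos M
  rcases lt_trichotomy l (M + 1) with h | h | h
  · obtain ⟨k, rfl⟩ : ∃ k, M = l + k := ⟨M - l, by omega⟩
    have h1 : l + k + 1 - l = k + 1 := by omega
    have h2 : l + k - l = k := by omega
    have hk := haA_pos k
    simp only [haL, haB, h1, h2, haA, if_pos (show l ≤ l + k + 1 by omega),
      if_pos (show l ≤ l + k by omega)]
    push_cast
    field_simp
    ring
  · subst h
    simp only [haL, haB, haA]
    simp
    field_simp
  · simp [haL, haB, Nat.not_le.2 h, show ¬ l ≤ M by omega]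

noncomputable def haR (l M : ℕ) : ℝ := ∑ i ∈ Finset.Ico l (M + 1), haL i M / i

lemma haR_step (l M : ℕ) (hl : 1 ≤ l) :
    haR l (M + 1) = haR l M + haB l (M + 1) / (((M : ℝ) + 1) * haA (M + 1)) := by
  rcases Nat.lt_or_ge (M + 1) l with h | h
  · simp [haR, haB, Finset.Ico_eq_empty_of_le (show M + 1 + 1 ≤ l by omega),
      Finset.Ico_eq_empty_of_le (show M + 1 ≤ l by omega), Nat.not_le.2 h]
  · have e : haR l M = ∑ i ∈ Finset.Ico l (M + 1 + 1), haL i M / i := by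
      rw [haR, Finset.sum_Ico_succ_top h, haL_zero (Nat.lt_succ_self M)]; simp
    rw [e, haR, ← sub_eq_iff_eq_add', ← Finset.sum_sub_distrib]
    have : ∀ i ∈ Finset.Ico l (M + 1 + 1), haL i (M + 1) / (i : ℝ) - haL i M / i =
        -(haB (i + 1) (M + 1) / (((M : ℝ) + 1) * haA (M + 1))
          - haB i (M + 1) / (((M : ℝ) + 1) * haA (M + 1))) := by
      intro i hi
      rw [← sub_div, haKey i M (by simp at hi; omega)]; ring
    rw [Finset.sum_congr rfl this, Finset.sum_neg_distrib,
      Finset.sum_Ico_sub (fun i => haB i (M + 1) / (((M : ℝ) + 1) * haA (M + 1))) (by omega)]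
    simp [haB]

lemma haR0 (l M : ℕ) (hl : 1 ≤ l) :
    ∑ m ∈ Finset.range (M + 1), haL l m / m = haR l M := by
  induction M with
  | zero => simp [haR, Finset.Ico_eq_empty_of_le hl]
  | succ M ih =>
    rw [Finset.sum_range_succ, ih, haR_step l M hl, haL, div_div]
    push_cast; ring

lemma haR1 (l M : ℕ) :
    ∑ m ∈ Finset.range M, haL l m / ((m : ℝ) + 1 / 2) = haR (l + 1) M := by
  induction M with
  | zero => simp [haR]
  | succ M ih =>
    rw [Finset.sum_range_succ, ih, haR_step (l + 1) M (by omega), haL, haB_succ, haA]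
    have := haA_pos M
    field_simp

lemma haEnd_partial (l k : ℕ) (hl : 1 ≤ l) :
    ∑ i ∈ Finset.range k, haL l (l + i) / (((l + i : ℕ) : ℝ) * (((l + i : ℕ) : ℝ) + 1 / 2)) =
      2 / l * ((k : ℝ) / ((l : ℝ) + k)) * haL l (l + k) := by
  have hl' : (0 : ℝ) < l := by exact_mod_cast hl
  induction k with
  | zero => simp
  | succ k ih =>
    rw [Finset.sum_range_succ, ih]
    have h2 : l + k - l = k := by omega
    have h3 : l + k + 1 - l = k + 1 := by omega
    have hk := haA_pos k
    have hk' := haA_pos (l + k)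
    simp only [haL, haB, h2, h3, ← add_assoc, haA_succ, if_pos (show l ≤ l + k + 1 by omega),
      if_pos (show l ≤ l + k by omega)]
    push_cast
    field_simp
    ring

open Filter Topology in
lemma haL_tendsto (l : ℕ) : Tendsto (fun k => haL l (l + k)) atTop (𝓝 1) := by
  induction l with
  | zero =>
    refine tendsto_const_nhds.congr fun k => ?_
    have := haA_pos k
    simp [haL, haB, this.ne']
  | succ l ih =>
    have h : Tendsto (fun k : ℕ => 1 + (1 / 2 : ℝ) / ((l : ℝ) + 1 / 2 + k)) atTop (𝓝 (1 + 0)) := by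
      refine tendsto_const_nhds.add (tendsto_const_nhds.div_atTop ?_)
      exact tendsto_atTop_add_const_left _ _ tendsto_natCast_atTop_atTop
    have := ih.mul h
    rw [add_zero, mul_one] at this
    refine this.congr fun k => ?_
    have e : l + 1 + k = (l + k) + 1 := by omega
    rw [e, haL, haL, haB_succ, haA]
    have := haA_pos (l + k)
    push_cast
    field_simp
    ring

open Filter Topology in
lemma haEnd (l : ℕ) (hl : 1 ≤ l) :
    HasSum (fun i => haL l (l + i) / (((l + i : ℕ) : ℝ) * (((l + i : ℕ) : ℝ) + 1 / 2)))
      (2 / (l : ℝ)) := by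
  have hl' : (0 : ℝ) < l := by exact_mod_cast hl
  rw [hasSum_iff_tendsto_nat_of_nonneg]
  · simp_rw [haEnd_partial l _ hl]
    have h : Tendsto (fun k : ℕ => (k : ℝ) / ((l : ℝ) + k)) atTop (𝓝 1) := by
      have h : Tendsto (fun k : ℕ => 1 - (l : ℝ) / ((l : ℝ) + k)) atTop (𝓝 (1 - 0)) := by
        refine tendsto_const_nhds.sub (tendsto_const_nhds.div_atTop ?_)
        exact tendsto_atTop_add_const_left _ _ tendsto_natCast_atTop_atTop
      rw [sub_zero] at h
      refine h.congr fun k => ?_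
      field_simp; ring
    simpa using (h.const_mul (2 / (l : ℝ))).mul (haL_tendsto l)
  · intro i
    exact div_nonneg (haL_nonneg _ _) (by positivity)

open scoped ENNReal

noncomputable def haV (w : ℕ → ℕ → ℝ≥0∞) (e : ℕ → ℝ≥0∞) : (n : ℕ) → (Fin (n + 1) → ℕ) → ℕ → ℝ≥0∞
  | 0, _, m => e m
  | n + 1, y, m => w (y 0) m * ∑' m', if m + y 0 ≤ m' then haV w e n (Fin.tail y) m' else 0

noncomputable def haT (w : ℕ → ℕ → ℝ≥0∞) (e : ℕ → ℝ≥0∞) (n : ℕ) (y f : Fin (n + 1) → ℕ) : ℝ≥0∞ :=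
  if ∀ i : Fin n, f i.castSucc + y i.castSucc ≤ f i.succ then
    (∏ i : Fin n, w (y i.castSucc) (f i.castSucc)) * e (f (Fin.last n)) else 0

lemma haT_cons (w : ℕ → ℕ → ℝ≥0∞) (e : ℕ → ℝ≥0∞) (n : ℕ) (y : Fin (n + 2) → ℕ) (m : ℕ)
    (g : Fin (n + 1) → ℕ) :
    haT w e (n + 1) y (Fin.cons m g) =
      w (y 0) m * if m + y 0 ≤ g 0 then haT w e n (Fin.tail y) g else 0 := by
  unfold haT
  simp only [Fin.forall_fin_succ, Fin.prod_univ_succ, Fin.tail, Fin.castSucc_zero, Fin.cons_zero,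
    Fin.cons_succ, ← Fin.succ_castSucc, ← Fin.succ_last]
  by_cases h1 : m + y 0 ≤ g 0
  · by_cases h2 : ∀ i : Fin n, g i.castSucc + y i.castSucc.succ ≤ g i.succ
    · simp [h1, h2, mul_assoc]
    · simp [h1, h2]
  · simp [h1]

lemma ha_tsum_cons (n : ℕ) (F : (Fin (n + 1) → ℕ) → ℝ≥0∞) :
    ∑' f, F f = ∑' m : ℕ, ∑' g : Fin n → ℕ, F (Fin.cons m g) := by
  rw [← (Fin.consEquiv (fun _ : Fin (n + 1) => ℕ)).tsum_eq, ENNReal.tsum_prod']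
  rfl

lemma haV_eq (w : ℕ → ℕ → ℝ≥0∞) (e : ℕ → ℝ≥0∞) (n : ℕ) (y : Fin (n + 1) → ℕ) (m : ℕ) :
    ∑' g : Fin n → ℕ, haT w e n y (Fin.cons m g) = haV w e n y m := by
  induction n generalizing m with
  | zero =>
    rw [tsum_eq_single default (fun b hb => absurd (Subsingleton.elim _ _) hb)]
    simp [haT, haV]
  | succ n ih =>
    simp only [haT_cons, haV, ENNReal.tsum_mul_left]
    congr 1
    rw [ha_tsum_cons]
    refine tsum_congr fun m' => ?_
    rw [← ih]
    simp only [Fin.cons_zero]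
    split_ifs <;> simp

lemma haT_total (w : ℕ → ℕ → ℝ≥0∞) (e : ℕ → ℝ≥0∞) (n : ℕ) (y : Fin (n + 1) → ℕ) (c : ℕ → ℝ≥0∞) :
    ∑' f : Fin (n + 1) → ℕ, c (f 0) * haT w e n y f = ∑' m, c m * haV w e n y m := by
  rw [ha_tsum_cons]
  refine tsum_congr fun m => ?_
  simp [← haV_eq, ENNReal.tsum_mul_left]

noncomputable def haK (l m : ℕ) : ℝ≥0∞ := ENNReal.ofReal (1 / 2 * (haL l m / l))
noncomputable def haWB (y m : ℕ) : ℝ≥0∞ := ENNReal.ofReal (1 / ((m : ℝ) + (y : ℝ) / 2))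
noncomputable def haWA (_y m : ℕ) : ℝ≥0∞ := ENNReal.ofReal (1 / (m : ℝ))
noncomputable def haEB (m : ℕ) : ℝ≥0∞ := ENNReal.ofReal (1 / (((m : ℝ) + 1 / 2) * m))
noncomputable def haEA (m : ℕ) : ℝ≥0∞ := ENNReal.ofReal (1 / ((m : ℝ) * m))

lemma haK_sum (l M : ℕ) :
    ∑' l', (if l ≤ l' then haK l' M else 0) = ENNReal.ofReal (1 / 2 * haR l M) := by
  rw [tsum_eq_sum (s := Finset.Ico l (M + 1)), haR, Finset.mul_sum, ENNReal.ofReal_sum_of_nonneg]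
  · refine Finset.sum_congr rfl fun i hi => ?_
    rw [if_pos (Finset.mem_Ico.1 hi).1, haK]
  · intro i _
    have := haL_nonneg i M
    positivity
  · intro b hb
    simp only [Finset.mem_Ico, not_and, not_lt] at hb
    split_ifs with h
    · rw [haK, haL_zero (hb h)]; simp
    · rfl

lemma ha_transport (l M y : ℕ) (hy : y ≤ 1) (hl : 1 ≤ l) :
    ∑' m, haK l m * (haWB y m * if m + y ≤ M then 1 else 0) =
      haWA y l * ∑' l', (if l + y ≤ l' then haK l' M else 0) := by
  have hR : ∑ m ∈ Finset.range (M + 1 - y), haL l m / ((m : ℝ) + (y : ℝ) / 2) = haR (l + y) M := by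
    interval_cases y
    · simpa using haR0 l M hl
    · simpa using haR1 l M
  rw [haK_sum, haWA, ← ENNReal.ofReal_mul (by positivity), ← hR,
    tsum_eq_sum (s := Finset.range (M + 1 - y)), Finset.mul_sum, Finset.mul_sum,
    ENNReal.ofReal_sum_of_nonneg]
  · refine Finset.sum_congr rfl fun m hm => ?_
    rw [if_pos (by simp at hm; omega), mul_one, haK, haWB, ← ENNReal.ofReal_mul]
    · congr 1; ring
    · have := haL_nonneg l m
      positivity
  · intro m _
    have := haL_nonneg l m
    positivity
  · intro m hm
    rw [if_neg (by simp at hm; omega)]; simp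

lemma ha_start (M : ℕ) :
    ∑' m, ENNReal.ofReal (1 / 2) * (haWB 1 m * if m + 1 ≤ M then 1 else 0) =
      ∑' l', (if 1 ≤ l' then haK l' M else 0) := by
  rw [haK_sum, ← zero_add 1, ← haR1, tsum_eq_sum (s := Finset.range M), Finset.mul_sum,
    ENNReal.ofReal_sum_of_nonneg]
  · refine Finset.sum_congr rfl fun m hm => ?_
    rw [if_pos (by simp at hm; omega), mul_one, haWB, ← ENNReal.ofReal_mul (by positivity)]
    have := haA_pos m
    simp [haL, haB, this.ne']
  · intro m _
    have := haL_nonneg 0 m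
    positivity
  · intro m hm
    rw [if_neg (by simp at hm; omega)]; simp

lemma ha_end (l : ℕ) (hl : 1 ≤ l) : ∑' m, haK l m * haEB m = haEA l := by
  have h := (haEnd l hl).mul_left (1 / 2 * (1 / (l : ℝ)))
  have hinj : Function.Injective (fun i => l + i) := add_right_injective l
  have e1 : ∑' m, haK l m * haEB m = ∑' i, haK l (l + i) * haEB (l + i) := by
    refine (hinj.tsum_eq (f := fun m => haK l m * haEB m) ?_).symm
    intro m hm
    by_contra hc
    apply hm
    have : m < l := by
      by_contra h'
      exact hc ⟨m - l, by simp; omega⟩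
    simp [haK, haL_zero this]
  have e2 : haEA l = ENNReal.ofReal (1 / 2 * (1 / (l : ℝ)) * (2 / l)) := by
    rw [haEA]; congr 1; field_simp
  rw [e1, e2, ← h.tsum_eq, ENNReal.ofReal_tsum_of_nonneg _ h.summable]
  · refine tsum_congr fun i => ?_
    have := haL_nonneg l (l + i)
    rw [haK, haEB, ← ENNReal.ofReal_mul (by positivity)]
    congr 1
    ring
  · intro i
    have := haL_nonneg l (l + i)
    positivity

lemma ha_swap (p : ℕ → ℝ≥0∞) (q : ℕ → ℝ≥0∞) (V : ℕ → ℝ≥0∞) (y : ℕ) :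
    ∑' m, p m * (q m * ∑' m', if m + y ≤ m' then V m' else 0) =
      ∑' m', (∑' m, p m * (q m * if m + y ≤ m' then 1 else 0)) * V m' := by
  simp_rw [← ENNReal.tsum_mul_left, ← ENNReal.tsum_mul_right]
  rw [ENNReal.tsum_comm]
  refine tsum_congr fun m' => tsum_congr fun m => ?_
  split_ifs <;> simp [mul_assoc]

lemma ha_swap2 (l : ℕ) (V : ℕ → ℝ≥0∞) :
    ∑' m', (∑' l', if l ≤ l' then haK l' m' else 0) * V m' =
      ∑' l', if l ≤ l' then ∑' m', haK l' m' * V m' else 0 := by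
  simp_rw [← ENNReal.tsum_mul_right]
  rw [ENNReal.tsum_comm]
  refine tsum_congr fun l' => ?_
  split_ifs <;> simp

lemma ha_main (n : ℕ) (y : Fin (n + 1) → ℕ) (hy : ∀ j, y j ≤ 1) (l : ℕ) (hl : 1 ≤ l) :
    ∑' m, haK l m * haV haWB haEB n y m = haV haWA haEA n y l := by
  induction n generalizing l with
  | zero => exact ha_end l hl
  | succ n ih =>
    simp only [haV]
    rw [ha_swap]
    simp_rw [ha_transport l _ _ (hy 0) hl, mul_assoc, ENNReal.tsum_mul_left]
    rw [ha_swap2]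
    congr 1
    refine tsum_congr fun l' => ?_
    split_ifs with h
    · exact ih (Fin.tail y) (fun j => hy _) l' (by omega)
    · rfl

lemma ha_full (n : ℕ) (y : Fin (n + 2) → ℕ) (hy : ∀ j, y j ≤ 1) (hy0 : y 0 = 1) :
    ENNReal.ofReal (1 / 2) * ∑' f, haT haWB haEB (n + 1) y f =
      ∑' f, (if 1 ≤ f 0 then 1 else 0) * haT haWA haEA n (Fin.tail y) f := by
  have h1 := haT_total haWB haEB (n + 1) y 1
  have h2 := haT_total haWA haEA n (Fin.tail y) (fun m => if 1 ≤ m then 1 else 0)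
  simp only [Pi.one_apply, one_mul] at h1
  rw [h1, h2, ← ENNReal.tsum_mul_left]
  simp only [haV, hy0]
  rw [ha_swap]
  simp_rw [ha_start]
  rw [ha_swap2]
  refine tsum_congr fun l => ?_
  split_ifs with h
  · rw [one_mul]; exact ha_main n _ (fun j => hy _) l h
  · simp

lemma ha_tsum_subtype {α : Type*} (P : α → Prop) [DecidablePred P] (r : α → ℝ) (hr : ∀ a, 0 ≤ r a) :
    ∑' a : {a // P a}, r a.1 = (∑' a, if P a then ENNReal.ofReal (r a) else 0).toReal := by
  have : ∑' a : {a // P a}, ENNReal.ofReal (r a.1) = ∑' a, if P a then ENNReal.ofReal (r a) else 0 := by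
    refine (tsum_subtype {a | P a} (fun a => ENNReal.ofReal (r a))).trans (tsum_congr fun a => ?_)
    simp [Set.indicator_apply]
  rw [← this, ENNReal.tsum_toReal_eq (fun _ => ENNReal.ofReal_ne_top)]
  exact tsum_congr fun a => (ENNReal.toReal_ofReal (hr _)).symm

/-- The β = 1/2 case of the Hurwitz-type series theorem (equivalent to Zhao's 2-1
formula). -/
theorem hurwitz_half_case (n : ℕ) (hn : 2 ≤ n) (y : Fin n → ℕ)
    (hy : ∀ j, y j ≤ 1)
    (hy0 : y ⟨0, by omega⟩ = 1)
    (hyl : y ⟨n - 1, by omega⟩ = 0) :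
    (1 / 2 : ℝ) * (∑' m : {f : Fin n → ℕ // ∀ i : Fin n, ∀ hi : (i : ℕ) + 1 < n,
        f i + y i ≤ f ⟨(i : ℕ) + 1, hi⟩},
      (1 : ℝ) / (((m.1 ⟨n - 1, by omega⟩ : ℝ) + 1 / 2) *
        ∏ j : Fin n, ((m.1 j : ℝ) + (y j : ℝ) / 2)))
    = ∑' m : {f : Fin (n - 1) → ℕ //
        y ⟨0, by omega⟩ ≤ f ⟨0, by omega⟩ ∧
        ∀ i : Fin (n - 1), ∀ hi : (i : ℕ) + 1 < n - 1,
          f i + y ⟨(i : ℕ) + 1, by omega⟩ ≤ f ⟨(i : ℕ) + 1, hi⟩},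
      (1 : ℝ) / ((∏ i : Fin (n - 1), (m.1 i : ℝ)) * (m.1 ⟨n - 2, by omega⟩ : ℝ)) := by
  classical
  obtain ⟨n, rfl⟩ : ∃ k, n = k + 2 := ⟨n - 2, by omega⟩
  have hF := congrArg ENNReal.toReal (ha_full n y hy hy0)
  rw [ENNReal.toReal_mul, ENNReal.toReal_ofReal (by norm_num)] at hF
  have hylast : y (Fin.last (n + 1)) = 0 := hyl
  have h1 := ha_tsum_subtype (fun f : Fin (n + 2) → ℕ => ∀ i : Fin (n + 2),
      ∀ hi : (i : ℕ) + 1 < n + 2, f i + y i ≤ f ⟨(i : ℕ) + 1, hi⟩)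
    (fun f => (1 : ℝ) / (((f (Fin.last (n + 1)) : ℝ) + 1 / 2) *
        ∏ j : Fin (n + 2), ((f j : ℝ) + (y j : ℝ) / 2))) (fun f => by positivity)
  have h2 := ha_tsum_subtype (fun f : Fin (n + 1) → ℕ => y 0 ≤ f 0 ∧ ∀ i : Fin (n + 1),
      ∀ hi : (i : ℕ) + 1 < n + 1, f i + y i.succ ≤ f ⟨(i : ℕ) + 1, hi⟩)
    (fun f => (1 : ℝ) / ((∏ j : Fin (n + 1), (f j : ℝ)) * (f (Fin.last n)))) (fun f => by positivity)
  refine (congrArg (fun t => (1 / 2 : ℝ) * t) h1).trans (Eq.trans ?_ h2.symm)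
  have g1 : ∀ f : Fin (n + 2) → ℕ, (if (∀ i : Fin (n + 2),
      ∀ hi : (i : ℕ) + 1 < n + 2, f i + y i ≤ f ⟨(i : ℕ) + 1, hi⟩) then
      ENNReal.ofReal ((1 : ℝ) / (((f (Fin.last (n + 1)) : ℝ) + 1 / 2) *
        ∏ j : Fin (n + 2), ((f j : ℝ) + (y j : ℝ) / 2))) else 0) = haT haWB haEB (n + 1) y f := by
    intro f
    unfold haT
    refine if_congr ?_ ?_ rfl
    · constructor
      · intro h i
        exact h i.castSucc (by have := i.isLt; simp only [Fin.val_castSucc]; omega)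
      · intro h i hi
        exact h ⟨i, by omega⟩
    · simp only [haWB, haEB]
      rw [← ENNReal.ofReal_prod_of_nonneg (fun i _ => by positivity),
        ← ENNReal.ofReal_mul (by positivity), Fin.prod_univ_castSucc, hylast]
      congr 1
      simp only [one_div, Finset.prod_inv_distrib, mul_inv]
      simp
      ring
  have g2 : ∀ f : Fin (n + 1) → ℕ, (if (y 0 ≤ f 0 ∧ ∀ i : Fin (n + 1),
      ∀ hi : (i : ℕ) + 1 < n + 1, f i + y i.succ ≤ f ⟨(i : ℕ) + 1, hi⟩) then
      ENNReal.ofReal ((1 : ℝ) / ((∏ j : Fin (n + 1), (f j : ℝ)) * (f (Fin.last n)))) else 0) =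
      (if 1 ≤ f 0 then 1 else 0) * haT haWA haEA n (Fin.tail y) f := by
    intro f
    rw [ite_and, show y 0 = 1 from hy0, ite_mul, one_mul, zero_mul]
    refine if_congr Iff.rfl ?_ rfl
    unfold haT
    refine if_congr ?_ ?_ rfl
    · constructor
      · intro h i
        exact h i.castSucc (by have := i.isLt; simp only [Fin.val_castSucc]; omega)
      · intro h i hi
        exact h ⟨i, by omega⟩
    · simp only [haWA, haEA]
      rw [← ENNReal.ofReal_prod_of_nonneg (fun i _ => by positivity),
        ← ENNReal.ofReal_mul (by positivity), Fin.prod_univ_castSucc]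
      congr 1
      simp only [one_div, Finset.prod_inv_distrib, mul_inv]
      ring
  simp only [g1, g2]
  exact hF
end
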